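/- arXiv:0907.4311 — 7 statements merged into one kernel-verified Lean document; each statement's English description precedes it below -/
import Mathlib

section
/- Let r ≥ 1 be an integer. For a vector s = (s_1, …, s_r) of nonnegative reals with s_1 + … + s_r ≤ 1, define F(s) = ∑_{i=1}^r s_i / max( ∑_{j=1}^i s_j , 1 − min_{1 ≤ j ≤ i} s_j ). Then F(s) ≤ F(s*) for the vector s* given by s*_i = 2^{−i} for 1 ≤ i < r and s*_r = 2^{−(r−1)}; that is, s* is an optimal solution of the mathematical program maximizing F over the simplex {s : s_i ≥ 0, ∑ s_i ≤ 1}. -/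
/-- The objective function of the mathematical program (MP_r) arising in the
worst-case analysis of the Subset Sum bin packing algorithm:
`F(s) = ∑_{i=1}^r s_i / max(∑_{j=1}^i s_j, 1 - min_{1 ≤ j ≤ i} s_j)`
(indices shifted to be 0-based). -/
noncomputable def ssObj (r : ℕ) (s : Fin r → ℝ) : ℝ :=
  ∑ i : Fin r, s i /
    max (∑ j ∈ Finset.Iic i, s j)
        (1 - (Finset.Iic i).inf' ⟨i, Finset.mem_Iic.mpr le_rfl⟩ s)

/-- The candidate optimal solution: `s*_i = 2^{-i}` for `1 ≤ i < r` and
`s*_r = 2^{-(r-1)}` (0-based: index `i` stands for item `i+1`). -/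
noncomputable def sStar (r : ℕ) : Fin r → ℝ := fun i =>
  if (i : ℕ) < r - 1 then (2 : ℝ) ^ (-((i : ℕ) : ℤ) - 1) else (2 : ℝ) ^ (-(r : ℤ) + 1)

/-- The excess `y / (1 - y) - y` of an item of size `y` charged at density `1 / (1 - y)`. -/
noncomputable def excess (y : ℝ) : ℝ := y ^ 2 / (1 - y)

/-- The total excess of the items `T / 2, T / 4, …, T / 2 ^ k`. -/
noncomputable def halvingExcess (k : ℕ) (T : ℝ) : ℝ :=
  ∑ i ∈ Finset.range k, excess (T * (1 / 2) ^ (i + 1))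

theorem excess_zero : excess 0 = 0 := by simp [excess]

theorem excess_nonneg {y : ℝ} (hy : y ≤ 1) : 0 ≤ excess y :=
  div_nonneg (sq_nonneg y) (by linarith)

theorem excess_mono {x y : ℝ} (hx : 0 ≤ x) (hxy : x ≤ y) (hy : y < 1) : excess x ≤ excess y := by
  have : 0 < 1 - y := by linarith
  unfold excess
  gcongr

theorem excess_convex {x y c : ℝ} (hx : x < 1) (hy : y < 1) (hc : 0 ≤ c) (hc1 : c ≤ 1) :
    excess ((1 - c) * x + c * y) ≤ (1 - c) * excess x + c * excess y := by
  have hx' : 0 < 1 - x := by linarith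
  have hy' : 0 < 1 - y := by linarith
  have hz : 0 < 1 - ((1 - c) * x + c * y) := by
    rcases eq_or_lt_of_le hc1 with rfl | h
    · linarith
    · nlinarith [mul_pos (sub_pos.2 h) hx', mul_nonneg hc hy'.le]
  have key : (1 - c) * excess x + c * excess y - excess ((1 - c) * x + c * y) =
      c * (1 - c) * (x - y) ^ 2 / ((1 - x) * (1 - y) * (1 - ((1 - c) * x + c * y))) := by
    unfold excess
    field_simp
    ring
  have : 0 ≤ c * (1 - c) * (x - y) ^ 2 /
      ((1 - x) * (1 - y) * (1 - ((1 - c) * x + c * y))) := by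
    have := sub_nonneg.2 hc1
    positivity
  linarith

theorem half_pow_succ_le (i : ℕ) : ((1 : ℝ) / 2) ^ (i + 1) ≤ 1 / 2 := by
  rw [pow_succ]
  have : ((1 : ℝ) / 2) ^ i ≤ 1 := pow_le_one₀ (by norm_num) (by norm_num)
  linarith

theorem mul_half_pow_succ_lt_one {T : ℝ} (hT : T ≤ 1) (i : ℕ) :
    T * (1 / 2) ^ (i + 1) < 1 := by
  have h := half_pow_succ_le i
  have h0 : (0 : ℝ) < (1 / 2) ^ (i + 1) := by positivity
  nlinarith

theorem halvingExcess_succ (k : ℕ) (T : ℝ) :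
    halvingExcess (k + 1) T = excess (T / 2) + halvingExcess k (T / 2) := by
  unfold halvingExcess
  rw [Finset.sum_range_succ', add_comm]
  congr 1
  · congr 1
    ring
  · refine Finset.sum_congr rfl fun i _ => ?_
    congr 1
    ring

theorem halvingExcess_le_succ (k : ℕ) {T : ℝ} (hT : T ≤ 1) :
    halvingExcess k T ≤ halvingExcess (k + 1) T := by
  unfold halvingExcess
  rw [Finset.sum_range_succ]
  linarith [excess_nonneg (mul_half_pow_succ_lt_one hT k).le]

theorem halvingExcess_mono (k : ℕ) {x y : ℝ} (hx : 0 ≤ x) (hxy : x ≤ y) (hy : y ≤ 1) :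
    halvingExcess k x ≤ halvingExcess k y := by
  refine Finset.sum_le_sum fun i _ => excess_mono (by positivity) ?_ (mul_half_pow_succ_lt_one hy i)
  gcongr

theorem halvingExcess_convex (k : ℕ) {x y c : ℝ} (hx : x ≤ 1) (hy : y ≤ 1) (hc : 0 ≤ c)
    (hc1 : c ≤ 1) :
    halvingExcess k ((1 - c) * x + c * y) ≤
      (1 - c) * halvingExcess k x + c * halvingExcess k y := by
  unfold halvingExcess
  rw [Finset.mul_sum, Finset.mul_sum, ← Finset.sum_add_distrib]
  refine Finset.sum_le_sum fun i _ => ?_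
  rw [show ((1 - c) * x + c * y) * (1 / 2) ^ (i + 1) =
    (1 - c) * (x * (1 / 2) ^ (i + 1)) + c * (y * (1 / 2) ^ (i + 1)) by ring]
  exact excess_convex (mul_half_pow_succ_lt_one hx i) (mul_half_pow_succ_lt_one hy i) hc hc1

/-- Splitting a total `a + b` into a first item `a` and a remainder `b` that is halved repeatedly
is no better than repeated halving from the start. -/
theorem div_add_halvingExcess_le (k : ℕ) {a b : ℝ} (ha : 0 ≤ a) (hb : 0 ≤ b) (hab : a + b ≤ 1) :
    a / (1 - min a b) + (b + halvingExcess k b) ≤ a + b + halvingExcess (k + 1) (a + b) := by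
  rcases le_or_gt b a with h | h
  · rw [min_eq_right h, halvingExcess_succ]
    have h1 := halvingExcess_mono k hb (show b ≤ (a + b) / 2 by linarith) (by linarith)
    have hb1 : 0 < 1 - b := by linarith
    have h2 : a / (1 - b) = a + a * b / (1 - b) := by
      field_simp
      ring
    have h3 : a * b / (1 - b) ≤ excess ((a + b) / 2) := by
      unfold excess
      have : 0 < 1 - (a + b) / 2 := by linarith
      gcongr
      · nlinarith [sq_nonneg (a - b)]
      · linarith
    linarith
  · rw [min_eq_left h.le]
    have hT : 0 < a + b := by linarith
    have ha1 : 0 < 1 - a := by linarith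
    have h2 : a / (1 - a) = a + excess a := by
      unfold excess
      field_simp
      ring
    obtain ⟨c, hc⟩ : ∃ c, c = 2 * a / (a + b) := ⟨_, rfl⟩
    have hc0 : 0 ≤ c := by rw [hc]; positivity
    have hc1 : c ≤ 1 := by rw [hc, div_le_one hT]; linarith
    have hca : c * (a + b) = 2 * a := by rw [hc]; field_simp
    have h3 := excess_convex (x := 0) (y := (a + b) / 2) zero_lt_one (by linarith) hc0 hc1
    have h4 := halvingExcess_convex k (x := a + b) (y := (a + b) / 2) hab (by linarith) hc0 hc1
    rw [show (1 - c) * 0 + c * ((a + b) / 2) = a by linarith, excess_zero] at h3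
    rw [show (1 - c) * (a + b) + c * ((a + b) / 2) = b by linarith] at h4
    have h5 := mul_le_mul_of_nonneg_left (halvingExcess_le_succ k hab) (sub_nonneg.2 hc1)
    have h6 := halvingExcess_succ k (a + b)
    rw [h6] at h5 ⊢
    linarith

theorem Fin.sum_Iic_succ {n : ℕ} (s : Fin (n + 1) → ℝ) (i : Fin n) :
    ∑ j ∈ Finset.Iic i.succ, s j = s 0 + ∑ j ∈ Finset.Iic i, s j.succ := by
  have h (m : ℕ) (t : Fin m → ℝ) (i : Fin m) :
      ∑ j ∈ Finset.Iic i, t j = ∑ j, if j ≤ i then t j else 0 := by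
    rw [← Finset.sum_filter]
    congr 1
    ext
    simp
  rw [h, h, Fin.sum_univ_succ]
  simp

theorem sum_div_one_sub_min_le (k : ℕ) (s : Fin (k + 1) → ℝ) {T : ℝ} (hT : T ≤ 1)
    (hpos : ∀ i, 0 ≤ s i) (hsum : ∑ i, s i ≤ T) :
    ∑ i, s i / (1 - min (s i) (T - ∑ j ∈ Finset.Iic i, s j)) ≤ T + halvingExcess k T := by
  induction k generalizing T with
  | zero =>
    have h0 := hpos 0
    have hI : Finset.Iic (0 : Fin (0 + 1)) = {0} := rfl
    rw [Fin.sum_univ_succ, Fin.sum_univ_zero, add_zero] at hsum ⊢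
    simp only [Finset.sum_singleton, hI, halvingExcess, Finset.range_zero, Finset.sum_empty,
      add_zero]
    rcases le_total (s 0) (T - s 0) with h | h
    · rw [min_eq_left h, div_le_iff₀ (by linarith)]
      nlinarith
    · rw [min_eq_right h]
      rcases h0.eq_or_lt with h' | h'
      · rw [← h', zero_div]; linarith
      · rw [div_le_iff₀ (by linarith)]
        nlinarith
  | succ k ih =>
    rw [Fin.sum_univ_succ] at hsum ⊢
    have htail : 0 ≤ ∑ i : Fin (k + 1), s i.succ := Finset.sum_nonneg fun i _ => hpos _
    have h0 := hpos 0
    have hrest := ih (fun i => s i.succ) (T := T - s 0) (by linarith) (fun i => hpos _)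
      (by linarith)
    have hfirst := div_add_halvingExcess_le k h0 (show 0 ≤ T - s 0 by linarith) (by linarith)
    have hI : Finset.Iic (0 : Fin (k + 2)) = {0} := by ext; simp
    simp only [Fin.sum_Iic_succ, hI, Finset.sum_singleton, ← sub_sub]
    rw [add_sub_cancel] at hfirst
    linarith

theorem ssObj_le_halvingExcess (k : ℕ) (s : Fin (k + 1) → ℝ) (hpos : ∀ i, 0 ≤ s i)
    (hsum : ∑ i, s i ≤ 1) : ssObj (k + 1) s ≤ 1 + halvingExcess k 1 := by
  refine le_trans (Finset.sum_le_sum fun i _ => ?_) (sum_div_one_sub_min_le k s le_rfl hpos hsum)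
  rcases (hpos i).eq_or_lt with h | h
  · simp [← h]
  have hi : s i ≤ ∑ j ∈ Finset.Iic i, s j :=
    Finset.single_le_sum (fun j _ => hpos j) (Finset.mem_Iic.2 le_rfl)
  have hinf := Finset.inf'_le s (Finset.mem_Iic.2 (le_refl i))
  have hmin : 1 - min (s i) (1 - ∑ j ∈ Finset.Iic i, s j) =
      max (∑ j ∈ Finset.Iic i, s j) (1 - s i) := by
    rw [← max_sub_sub_left, sub_sub_cancel, max_comm]
  rw [hmin]
  have : 0 < max (∑ j ∈ Finset.Iic i, s j) (1 - s i) := lt_max_of_lt_left (h.trans_le hi)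
  gcongr

theorem sStar_castSucc {k : ℕ} (i : Fin k) :
    sStar (k + 1) i.castSucc = (1 / 2) ^ ((i : ℕ) + 1) := by
  have h : -((i : ℕ) : ℤ) - 1 = -(((i : ℕ) + 1 : ℕ) : ℤ) := by push_cast; ring
  simp only [sStar, Fin.val_castSucc, Nat.add_sub_cancel, i.isLt, if_true, h]
  rw [zpow_neg, zpow_natCast, one_div, inv_pow]

theorem sStar_last (k : ℕ) : sStar (k + 1) (Fin.last k) = (1 / 2) ^ k := by
  have h : -((k + 1 : ℕ) : ℤ) + 1 = -(k : ℤ) := by push_cast; ring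
  simp only [sStar, Fin.val_last, Nat.add_sub_cancel, lt_irrefl, if_false, h]
  rw [zpow_neg, zpow_natCast, one_div, inv_pow]

theorem sum_half_pow_succ (n : ℕ) :
    ∑ i ∈ Finset.range n, ((1 : ℝ) / 2) ^ (i + 1) = 1 - (1 / 2) ^ n := by
  induction n with
  | zero => simp
  | succ n ih => rw [Finset.sum_range_succ, ih]; ring

theorem sum_Iic_sStar_castSucc {k : ℕ} (i : Fin k) :
    ∑ j ∈ Finset.Iic i.castSucc, sStar (k + 1) j = 1 - (1 / 2) ^ ((i : ℕ) + 1) := by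
  rw [← sum_half_pow_succ, Nat.range_succ_eq_Iic, ← Fin.val_castSucc,
    ← Fin.map_valEmbedding_Iic, Finset.sum_map]
  refine Finset.sum_congr rfl fun j hj => ?_
  obtain ⟨j, rfl⟩ := Fin.exists_castSucc_eq.2
    (ne_of_lt ((Finset.mem_Iic.1 hj).trans_lt (Fin.castSucc_lt_last i)))
  simp [sStar_castSucc]

theorem sum_sStar (k : ℕ) : ∑ j, sStar (k + 1) j = 1 := by
  rw [Fin.sum_univ_castSucc, sStar_last]
  simp only [sStar_castSucc]
  rw [Fin.sum_univ_eq_sum_range (fun i => ((1 : ℝ) / 2) ^ (i + 1)), sum_half_pow_succ]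
  ring

theorem sStar_nonneg (r : ℕ) (i : Fin r) : 0 ≤ sStar r i := by
  unfold sStar
  split_ifs <;> positivity

theorem halvingExcess_le_ssObj_sStar (k : ℕ) :
    1 + halvingExcess k 1 ≤ ssObj (k + 1) (sStar (k + 1)) := by
  have hinit (i : Fin k) : (1 / 2) ^ ((i : ℕ) + 1) + excess (1 * (1 / 2) ^ ((i : ℕ) + 1)) ≤
      sStar (k + 1) i.castSucc / max (∑ j ∈ Finset.Iic i.castSucc, sStar (k + 1) j)
        (1 - (Finset.Iic i.castSucc).inf' ⟨_, Finset.mem_Iic.mpr le_rfl⟩ (sStar (k + 1))) := by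
    have hinf : (1 / 2) ^ ((i : ℕ) + 1) ≤
        (Finset.Iic i.castSucc).inf' ⟨_, Finset.mem_Iic.mpr le_rfl⟩ (sStar (k + 1)) := by
      refine Finset.le_inf' _ _ fun j hj => ?_
      have hj := Finset.mem_Iic.1 hj
      obtain ⟨j, rfl⟩ := Fin.exists_castSucc_eq.2
        (ne_of_lt (hj.trans_lt (Fin.castSucc_lt_last i)))
      rw [sStar_castSucc]
      exact pow_le_pow_of_le_one (by norm_num) (by norm_num)
        (Nat.succ_le_succ (Fin.castSucc_le_castSucc_iff.1 hj))
    have hlt : 0 < 1 - ((1 : ℝ) / 2) ^ ((i : ℕ) + 1) := by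
      linarith [half_pow_succ_le (i : ℕ)]
    rw [sum_Iic_sStar_castSucc, max_eq_left (by linarith), sStar_castSucc, one_mul, excess]
    apply le_of_eq
    field_simp
    ring
  have hlast : ((1 : ℝ) / 2) ^ k ≤
      sStar (k + 1) (Fin.last k) / max (∑ j ∈ Finset.Iic (Fin.last k), sStar (k + 1) j)
        (1 - (Finset.Iic (Fin.last k)).inf' ⟨_, Finset.mem_Iic.mpr le_rfl⟩ (sStar (k + 1))) := by
    have hinf : 0 ≤ (Finset.Iic (Fin.last k)).inf' ⟨_, Finset.mem_Iic.mpr le_rfl⟩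
        (sStar (k + 1)) := Finset.le_inf' _ _ fun j _ => sStar_nonneg _ j
    have hI : Finset.Iic (Fin.last k) = Finset.univ := by ext; simp [Fin.le_last]
    have hs : ∑ j ∈ Finset.Iic (Fin.last k), sStar (k + 1) j = 1 := by rw [hI, sum_sStar]
    rw [hs, max_eq_left (by linarith), sStar_last, div_one]
  have h := add_le_add (Finset.sum_le_sum fun i (_ : i ∈ Finset.univ) => hinit i) hlast
  rw [Finset.sum_add_distrib, Fin.sum_univ_eq_sum_range (fun i => ((1 : ℝ) / 2) ^ (i + 1)),
    Fin.sum_univ_eq_sum_range (fun i => excess (1 * (1 / 2) ^ (i + 1))), sum_half_pow_succ] at h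
  unfold ssObj
  rw [Fin.sum_univ_castSucc]
  unfold halvingExcess
  linarith

/-- `s*` is an optimal solution of (MP_r): for every feasible `s`,
`F(s) ≤ F(s*)`. -/
theorem ssObj_le_ssObj_sStar (r : ℕ) (hr : 1 ≤ r) (s : Fin r → ℝ)
    (hpos : ∀ i, 0 ≤ s i) (hsum : ∑ i, s i ≤ 1) :
    ssObj r s ≤ ssObj r (sStar r) := by
  obtain ⟨k, rfl⟩ := Nat.exists_eq_add_of_le' hr
  exact (ssObj_le_halvingExcess k s hpos hsum).trans (halvingExcess_le_ssObj_sStar k)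
end

section
/- Let I be a finite list of items, each with a real size in (0, 1]. Let B_1, …, B_m be a subset-sum (SS) packing of I and let O_1, …, O_n be any packing of I. Then m ≤ λ·n + 1, where λ = ∑_{i=1}^∞ 1/(2^i − 1). In particular, the asymptotic worst-case approximation ratio of the Subset Sum algorithm for bin packing equals λ ≈ 1.6067. -/
/-- The load of bin `k` in the assignment `f` of items to `m` bins. -/
noncomputable def binLoad {ι : Type*} [Fintype ι] (size : ι → ℝ) {m : ℕ}
    (f : ι → Fin m) (k : Fin m) : ℝ :=
  ∑ i ∈ Finset.univ.filter (fun i => f i = k), size i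

/-- `f` is a packing of the items into `m` (nonempty) bins: every bin is used and
the total size of the items in each bin is at most 1. -/
def IsPacking {ι : Type*} [Fintype ι] (size : ι → ℝ) (m : ℕ) (f : ι → Fin m) : Prop :=
  Function.Surjective f ∧ ∀ k : Fin m, binLoad size f k ≤ 1

/-- `f` is a subset-sum (SS) packing: it is a packing and, for every bin `k`, the
total size of bin `k` is at least the total size of every subset `S` of the items
not packed in earlier bins whose total size is at most 1. -/
def IsSSPacking {ι : Type*} [Fintype ι] (size : ι → ℝ) (m : ℕ) (f : ι → Fin m) : Prop :=
  IsPacking size m f ∧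
    ∀ k : Fin m, ∀ S : Finset ι, (∀ i ∈ S, k ≤ f i) → ∑ i ∈ S, size i ≤ 1 →
      ∑ i ∈ S, size i ≤ binLoad size f k

/-- The potential `r ↦ ∑_{i ≥ 1} (r / 2^i) / (1 - r / 2^i)`: the largest total weight of the items
that can be packed on top of a partial bin with free capacity `r`. -/
noncomputable def dyadicPotential (r : ℝ) : ℝ :=
  ∑' i : ℕ, (r / 2 ^ (i + 1)) / (1 - r / 2 ^ (i + 1))

lemma div_two_pow_succ_mem {r : ℝ} (h0 : 0 ≤ r) (h1 : r ≤ 1) (i : ℕ) :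
    0 ≤ r / 2 ^ (i + 1) ∧ r / 2 ^ (i + 1) ≤ 1 / 2 := by
  refine ⟨by positivity, ?_⟩
  rw [div_le_div_iff₀ (by positivity) (by norm_num)]
  have : (1 : ℝ) ≤ 2 ^ i := one_le_pow₀ (by norm_num)
  rw [pow_succ]
  nlinarith

lemma hasSum_div_two_pow_succ (r : ℝ) : HasSum (fun i : ℕ => r / 2 ^ (i + 1)) r := by
  refine (hasSum_geometric_two' r).congr_fun fun i => ?_
  rw [pow_succ]
  field_simp

lemma summable_dyadicPotential {r : ℝ} (h0 : 0 ≤ r) (h1 : r ≤ 1) :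
    Summable fun i : ℕ => (r / 2 ^ (i + 1)) / (1 - r / 2 ^ (i + 1)) := by
  refine Summable.of_nonneg_of_le (fun i => ?_) (fun i => ?_)
    ((hasSum_div_two_pow_succ r).summable.mul_left 2)
  · obtain ⟨h, h'⟩ := div_two_pow_succ_mem h0 h1 i
    exact div_nonneg h (by linarith)
  · obtain ⟨h, h'⟩ := div_two_pow_succ_mem h0 h1 i
    rw [div_le_iff₀ (by linarith)]
    nlinarith

lemma dyadicPotential_nonneg {r : ℝ} (h0 : 0 ≤ r) (h1 : r ≤ 1) : 0 ≤ dyadicPotential r :=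
  tsum_nonneg fun i => by
    obtain ⟨h, h'⟩ := div_two_pow_succ_mem h0 h1 i
    exact div_nonneg h (by linarith)

lemma dyadicPotential_one :
    dyadicPotential 1 = ∑' i : ℕ, 1 / ((2 : ℝ) ^ (i + 1) - 1) := by
  refine tsum_congr fun i => ?_
  have h : (1 : ℝ) < 2 ^ (i + 1) := one_lt_pow₀ (by norm_num) (by omega)
  have h' : (2 : ℝ) ^ (i + 1) - 1 ≠ 0 := by linarith
  have h'' : (1 : ℝ) - 1 / 2 ^ (i + 1) ≠ 0 := by
    have : (1 : ℝ) - 1 / 2 ^ (i + 1) = (2 ^ (i + 1) - 1) / 2 ^ (i + 1) := by field_simp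
    rw [this]
    positivity
  field_simp

lemma dyadicPotential_eq_add_half {r : ℝ} (h0 : 0 ≤ r) (h1 : r ≤ 1) :
    dyadicPotential r = (r / 2) / (1 - r / 2) + dyadicPotential (r / 2) := by
  unfold dyadicPotential
  rw [(summable_dyadicPotential h0 h1).tsum_eq_zero_add]
  congr 1
  · norm_num
  · refine tsum_congr fun i => ?_
    rw [pow_succ _ (i + 1), div_div r 2, mul_comm (2 : ℝ)]

lemma sub_le_dyadicPotential_sub {u v : ℝ} (hu : 0 ≤ u) (huv : u ≤ v) (hv : v ≤ 1) :
    v - u ≤ dyadicPotential v - dyadicPotential u := by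
  have hs := (summable_dyadicPotential (hu.trans huv) hv).hasSum.sub
    (summable_dyadicPotential hu (huv.trans hv)).hasSum
  refine hasSum_le (fun i => ?_)
    ((hasSum_div_two_pow_succ v).sub (hasSum_div_two_pow_succ u)) hs
  obtain ⟨h1, h2⟩ := div_two_pow_succ_mem hu (huv.trans hv) i
  obtain ⟨h3, h4⟩ := div_two_pow_succ_mem (hu.trans huv) hv i
  have h5 : u / 2 ^ (i + 1) ≤ v / 2 ^ (i + 1) := by gcongr
  generalize u / 2 ^ (i + 1) = x at *
  generalize v / 2 ^ (i + 1) = y at *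
  rw [div_sub_div _ _ (by linarith) (by linarith), le_div_iff₀ (by nlinarith)]
  nlinarith [mul_nonneg (sub_nonneg.2 h5) (show 0 ≤ x + y - x * y by nlinarith)]

lemma convexOn_div_one_sub : ConvexOn ℝ (Set.Iio (1 : ℝ)) fun x => x / (1 - x) := by
  refine ⟨convex_Iio 1, fun x hx y hy a b ha hb hab => ?_⟩
  have hx' : 0 < 1 - x := sub_pos.2 hx
  have hy' : 0 < 1 - y := sub_pos.2 hy
  have hz : 0 < 1 - (a * x + b * y) := by
    have : 1 - (a * x + b * y) = a * (1 - x) + b * (1 - y) := by linear_combination -hab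
    rw [this]
    rcases ha.eq_or_lt with rfl | ha
    · have : b = 1 := by linarith
      subst this; linarith
    · positivity
  simp only [smul_eq_mul]
  rw [← sub_nonneg]
  obtain rfl : b = 1 - a := by linarith
  have : a * (x / (1 - x)) + (1 - a) * (y / (1 - y))
      - (a * x + (1 - a) * y) / (1 - (a * x + (1 - a) * y))
      = a * (1 - a) * (x - y) ^ 2 / ((1 - x) * (1 - y) * (1 - (a * x + (1 - a) * y))) := by
    field_simp
    ring
  rw [this]
  positivity

lemma dyadicPotential_convexOn : ConvexOn ℝ (Set.Icc 0 1) dyadicPotential := by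
  refine ⟨convex_Icc 0 1, fun x hx y hy a b ha hb hab => ?_⟩
  have hz := convex_Icc (0 : ℝ) 1 hx hy ha hb hab
  refine hasSum_le (fun i => ?_) (summable_dyadicPotential hz.1 hz.2).hasSum
    (((summable_dyadicPotential hx.1 hx.2).hasSum.mul_left a).add
      ((summable_dyadicPotential hy.1 hy.2).hasSum.mul_left b))
  have h1 := (div_two_pow_succ_mem hx.1 hx.2 i).2
  have h2 := (div_two_pow_succ_mem hy.1 hy.2 i).2
  have := convexOn_div_one_sub.2 (x := x / 2 ^ (i + 1)) (y := y / 2 ^ (i + 1))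
    (Set.mem_Iio.2 (by linarith)) (Set.mem_Iio.2 (by linarith)) ha hb hab
  simp only [smul_eq_mul] at this ⊢
  rwa [← mul_div_assoc, ← mul_div_assoc, ← add_div] at this

lemma div_max_add_dyadicPotential_le {a r : ℝ} (ha : 0 < a) (har : a ≤ r) (hr : r ≤ 1) :
    a / max (1 - (r - a)) (1 - a) + dyadicPotential (r - a) ≤ dyadicPotential r := by
  have hhalf := dyadicPotential_eq_add_half (ha.le.trans har) hr
  rcases le_total a (r / 2) with h | h
  · rw [max_eq_right (by linarith)]
    have hr0 : 0 < r := by linarith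
    set θ := a / (r / 2) with hθ
    have hθ0 : 0 ≤ θ := by positivity
    have hθ1 : θ ≤ 1 := by rw [hθ, div_le_one (by linarith)]; exact h
    have hθa : θ * (r / 2) = a := by rw [hθ]; field_simp
    have h1 := convexOn_div_one_sub.2 (show (0 : ℝ) ∈ Set.Iio 1 by simp)
      (show r / 2 ∈ Set.Iio 1 from Set.mem_Iio.2 (by linarith)) (sub_nonneg.2 hθ1) hθ0 (by ring)
    have h2 := dyadicPotential_convexOn.2 (show r ∈ Set.Icc 0 1 from ⟨hr0.le, hr⟩)
      (show r / 2 ∈ Set.Icc 0 1 from ⟨by linarith, by linarith⟩) (sub_nonneg.2 hθ1) hθ0 (by ring)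
    simp only [smul_eq_mul, mul_zero, zero_add, zero_div, hθa] at h1 h2
    rw [show (1 - θ) * r + a = r - a by linear_combination -2 * hθa] at h2
    have h3 : θ * dyadicPotential r
        = θ * ((r / 2) / (1 - r / 2)) + θ * dyadicPotential (r / 2) := by
      rw [hhalf]; ring
    linarith
  · rw [max_eq_left (by linarith)]
    obtain ⟨u, rfl⟩ : ∃ u, a = r - u := ⟨r - a, by ring⟩
    obtain ⟨v, rfl⟩ : ∃ v, r = 2 * v := ⟨r / 2, by ring⟩
    rw [show 2 * v / 2 = v by ring] at hhalf h
    rw [show 2 * v - (2 * v - u) = u by ring, hhalf]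
    have h1 := sub_le_dyadicPotential_sub (u := u) (v := v) (by linarith) (by linarith)
      (by linarith)
    have h2 : (2 * v - u) / (1 - u) - v / (1 - v) ≤ v - u := by
      rw [div_sub_div _ _ (by linarith) (by linarith),
        div_le_iff₀ (mul_pos (by linarith) (by linarith))]
      have huv : 0 ≤ v - u := by linarith
      have hu : 0 ≤ u := by linarith
      nlinarith [mul_nonneg huv (show 0 ≤ v - u + u * v by nlinarith)]
    linarith

lemma sum_div_max_add_dyadicPotential_le {ι κ : Type*} [LinearOrder κ] (size : ι → ℝ) (f : ι → κ)
    (hsize : ∀ i, 0 < size i) (s : Finset ι) (hs : ∑ i ∈ s, size i ≤ 1) :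
    ∑ i ∈ s, size i / max (∑ j ∈ s with f i ≤ f j, size j) (1 - size i)
      + dyadicPotential (1 - ∑ i ∈ s, size i) ≤ dyadicPotential 1 := by
  classical
  induction s using Finset.induction_on_min_value f with
  | empty => simp
  | insert a s ha hmin ih =>
    rw [Finset.sum_insert ha] at hs ⊢
    have hpos : 0 ≤ ∑ i ∈ s, size i := Finset.sum_nonneg fun i _ => (hsize i).le
    have hrest : ∑ i ∈ s, size i / max (∑ j ∈ insert a s with f i ≤ f j, size j) (1 - size i)
        ≤ ∑ i ∈ s, size i / max (∑ j ∈ s with f i ≤ f j, size j) (1 - size i) := by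
      refine Finset.sum_le_sum fun i hi => ?_
      have h1 : size i ≤ ∑ j ∈ s with f i ≤ f j, size j :=
        Finset.single_le_sum (f := size) (fun j _ => (hsize j).le) (by simp [hi])
      have h2 : ∑ j ∈ s with f i ≤ f j, size j ≤ ∑ j ∈ insert a s with f i ≤ f j, size j :=
        Finset.sum_le_sum_of_subset_of_nonneg
          (Finset.filter_subset_filter _ (Finset.subset_insert a s)) fun j _ _ => (hsize j).le
      exact div_le_div_of_nonneg_left (hsize i).le
        (lt_max_of_lt_left ((hsize i).trans_le h1)) (max_le_max_right _ h2)
    have hall : ∑ j ∈ insert a s with f a ≤ f j, size j = size a + ∑ i ∈ s, size i := by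
      rw [Finset.filter_true_of_mem, Finset.sum_insert ha]
      simpa using hmin
    have hstep := div_max_add_dyadicPotential_le (a := size a) (r := 1 - ∑ i ∈ s, size i)
      (hsize a) (by linarith) (by linarith)
    rw [show 1 - (1 - ∑ i ∈ s, size i - size a) = size a + ∑ i ∈ s, size i by ring,
      show 1 - ∑ i ∈ s, size i - size a = 1 - (size a + ∑ i ∈ s, size i) by ring] at hstep
    rw [Finset.sum_insert ha, hall]
    linarith [ih (by linarith [hsize a])]

lemma sum_one_sub_div_le (L : ℕ → ℝ) (h0 : L 0 = 1) (k : ℕ) (hpos : ∀ i ≤ k, 0 < L i)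
    (hanti : ∀ i < k, L (i + 1) ≤ L i) :
    ∑ i ∈ Finset.range k, (1 - L (i + 1) / L i) ≤ 1 / L k - 1 ∧ L k ≤ 1 := by
  induction k with
  | zero => simp [h0]
  | succ k ih =>
    obtain ⟨h1, h2⟩ := ih (fun i hi => hpos i (by omega)) (fun i hi => hanti i (by omega))
    have hx := hpos k (by omega)
    have hy := hpos (k + 1) le_rfl
    have hxy := hanti k (by omega)
    refine ⟨?_, hxy.trans h2⟩
    rw [Finset.sum_range_succ]
    have h3 : (1 - L (k + 1)) / L k ≤ (1 - L (k + 1)) / L (k + 1) :=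
      div_le_div_of_nonneg_left (by linarith) hy hxy
    rw [sub_div, sub_div, div_self hy.ne'] at h3
    linarith

/-- If consecutive terms of a decreasing sequence starting at `1` have sum at least `1`,
then the successive ratios of its first `k + 1` steps fall short of `1` by at most `1` in total. -/
lemma le_sum_div_add_one (L : ℕ → ℝ) (h0 : L 0 = 1) (k : ℕ) (hpos : ∀ i ≤ k + 1, 0 < L i)
    (hanti : ∀ i < k, L (i + 1) ≤ L i) (hlast : 1 ≤ L k + L (k + 1)) :
    (k + 1 : ℝ) ≤ ∑ i ∈ Finset.range (k + 1), L (i + 1) / L i + 1 := by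
  have h1 := (sum_one_sub_div_le L h0 k (fun i hi => hpos i (by omega)) hanti).1
  have hx := hpos k (by omega)
  rw [Finset.sum_sub_distrib] at h1
  simp only [Finset.sum_const, Finset.card_range, nsmul_eq_mul, mul_one] at h1
  rw [Finset.sum_range_succ]
  have h2 : 1 / L k - 1 ≤ L (k + 1) / L k := by
    rw [sub_le_iff_le_add, ← div_self hx.ne', ← add_div, div_self hx.ne']
    gcongr
    linarith
  linarith

section SSPacking

variable {ι : Type*} [Fintype ι] {size : ι → ℝ} {m : ℕ} {f : ι → Fin m}

lemma IsPacking.binLoad_pos (hf : IsPacking size m f) (hsize : ∀ i, 0 < size i) (k : Fin m) :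
    0 < binLoad size f k := by
  obtain ⟨i, hi⟩ := hf.1 k
  exact Finset.sum_pos (fun j _ => hsize j) ⟨i, by simp [hi]⟩

lemma IsSSPacking.binLoad_antitone (hf : IsSSPacking size m f) : Antitone (binLoad size f) :=
  fun j k hjk => hf.2 j _ (fun i hi => by simpa [(Finset.mem_filter.1 hi).2] using hjk) (hf.1.2 k)

lemma IsSSPacking.one_lt_binLoad_add (hf : IsSSPacking size m f) {i : ι} (hi : 0 < size i)
    {k : Fin m} (hk : k < f i) : 1 < binLoad size f k + size i := by
  classical
  by_contra! hle
  have hni : i ∉ Finset.univ.filter fun j => f j = k := by simp [hk.ne']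
  have hsum : ∑ j ∈ insert i (Finset.univ.filter fun j => f j = k), size j
      = binLoad size f k + size i := by
    rw [Finset.sum_insert hni, add_comm, binLoad]
  have := hf.2 k (insert i (Finset.univ.filter fun j => f j = k))
    (fun j hj => by
      rcases Finset.mem_insert.1 hj with rfl | hj
      · exact hk.le
      · exact (Finset.mem_filter.1 hj).2.ge)
    (hsum.trans_le hle)
  linarith

end SSPacking

/-- Upper bound on the Subset Sum algorithm: if `f` is an SS packing into `m` bins
and `g` is any packing into `n` bins, then `m ≤ λ·n + 1` where
`λ = ∑_{i=1}^∞ 1/(2^i - 1) ≈ 1.6067`. -/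
theorem ssPacking_le {ι : Type*} [Fintype ι] (size : ι → ℝ)
    (hsize : ∀ i, size i ∈ Set.Ioc (0 : ℝ) 1) {m n : ℕ}
    (f : ι → Fin m) (g : ι → Fin n)
    (hf : IsSSPacking size m f) (hg : IsPacking size n g) :
    (m : ℝ) ≤ (∑' i : ℕ, 1 / ((2 : ℝ) ^ (i + 1) - 1)) * n + 1 := by
  rcases m with _ | k
  · have := dyadicPotential_nonneg zero_le_one le_rfl
    rw [dyadicPotential_one] at this
    push_cast
    positivity
  have hpos : ∀ i, 0 < size i := fun i => (hsize i).1
  set T : ι → ℝ := fun i =>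
    ∑ j ∈ (Finset.univ.filter fun j => g j = g i) with f i ≤ f j, size j with hT
  set w : ι → ℝ := fun i => size i / max (T i) (1 - size i) with hw
  have hupper : ∑ i, w i ≤ dyadicPotential 1 * n := by
    rw [← Finset.sum_fiberwise Finset.univ g w]
    have hbin : ∀ b : Fin n, ∑ i with g i = b, w i ≤ dyadicPotential 1 := fun b => by
      have hb := sum_div_max_add_dyadicPotential_le size f hpos
        (Finset.univ.filter fun i => g i = b) (hg.2 b)
      have hnn : 0 ≤ ∑ i with g i = b, size i := Finset.sum_nonneg fun i _ => (hpos i).le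
      have hΦ := dyadicPotential_nonneg (r := 1 - ∑ i with g i = b, size i)
        (sub_nonneg.2 (hg.2 b)) (by linarith)
      refine (Finset.sum_congr rfl fun i hi => ?_).trans_le
        (le_of_add_le_of_nonneg_left hb hΦ)
      simp only [hw, hT, (Finset.mem_filter.1 hi).2]
    refine (Finset.sum_le_sum fun b _ => hbin b).trans_eq ?_
    simp [mul_comm]
  have hTle : ∀ i, T i ≤ binLoad size f (f i) := fun i => by
    refine hf.2 (f i) _ (fun j hj => (Finset.mem_filter.1 hj).2) (le_trans ?_ (hg.2 (g i)))
    exact Finset.sum_le_sum_of_subset_of_nonneg (Finset.filter_subset _ _)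
      fun j _ _ => (hpos j).le
  have hTpos : ∀ i, 0 < T i := fun i => Finset.sum_pos (fun j _ => hpos j) ⟨i, by simp⟩
  -- `L 0 = 1`, and `L (i + 1)` is the load of bin `i`
  let L : ℕ → ℝ := fun i => if i = 0 then 1 else binLoad size f (Fin.ofNat (k + 1) (i - 1))
  have hL : ∀ b : Fin (k + 1), L (b + 1) = binLoad size f b := fun b => by simp [L]
  have hLpos : ∀ i, 0 < L i := fun i => by
    simp only [L]
    split_ifs
    · exact one_pos
    · exact hf.1.binLoad_pos hpos _
  have hLanti : ∀ i < k + 1, L (i + 1) ≤ L i := fun i hi => by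
    rw [hL ⟨i, hi⟩]
    rcases i with _ | i
    · exact hf.1.2 _
    · rw [hL ⟨i, by omega⟩]
      exact hf.binLoad_antitone (Fin.mk_le_mk.2 (by omega))
  have hprev : ∀ i, 1 ≤ L (f i) + size i := fun i => by
    rcases h : (f i : ℕ) with _ | j
    · simp [L, (hpos i).le]
    · have hj : j < k + 1 := by have := (f i).2; omega
      rw [hL ⟨j, hj⟩]
      exact (hf.one_lt_binLoad_add (hpos i) (Fin.lt_def.2 (by simp [h]))).le
  have hsize_le : ∀ i, size i ≤ L (f i + 1) := fun i => by
    rw [hL]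
    exact Finset.single_le_sum (f := size) (fun j _ => (hpos j).le) (by simp)
  have hlast : 1 ≤ L k + L (k + 1) := by
    obtain ⟨i, hi⟩ := hf.1.1 (Fin.last k)
    have h1 := hprev i
    have h2 := hsize_le i
    rw [hi, Fin.val_last] at h1 h2
    linarith
  have hlower : ∑ b ∈ Finset.range (k + 1), L (b + 1) / L b ≤ ∑ i, w i := by
    rw [← Finset.sum_fiberwise Finset.univ f w, Finset.sum_range]
    refine Finset.sum_le_sum fun b _ => ?_
    rw [hL, binLoad, Finset.sum_div]
    refine Finset.sum_le_sum fun i hi => ?_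
    obtain rfl := (Finset.mem_filter.1 hi).2
    refine div_le_div_of_nonneg_left (hpos i).le (lt_max_of_lt_left (hTpos i)) (max_le ?_ ?_)
    · exact (hTle i).trans ((hL (f i)).symm.trans_le (hLanti _ (f i).2))
    · linarith [hprev i]
  have hcount := le_sum_div_add_one L (by simp [L]) k (fun i _ => hLpos i)
    (fun i hi => hLanti i (by omega)) hlast
  rw [← dyadicPotential_one]
  push_cast
  linarith
end

section
/- For every δ > 0 there exists a finite list I of items with sizes in (0, 1], a subset-sum (SS) packing of I using m bins, and a packing of I using n bins, such that m ≥ (λ − δ)·n, where λ = ∑_{i=1}^∞ 1/(2^i − 1). -/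
theorem binLoad_comp_equiv {ι κ : Type*} [Fintype ι] [Fintype κ] (e : κ ≃ ι) (size : ι → ℝ)
    {m : ℕ} (f : ι → Fin m) (k : Fin m) :
    binLoad (size ∘ e) (f ∘ e) k = binLoad size f k := by
  unfold binLoad
  rw [Finset.sum_filter, Finset.sum_filter]
  exact e.sum_comp fun i => if f i = k then size i else 0

theorem IsPacking.comp_equiv {ι κ : Type*} [Fintype ι] [Fintype κ] (e : κ ≃ ι) {size : ι → ℝ}
    {m : ℕ} {f : ι → Fin m} (h : IsPacking size m f) : IsPacking (size ∘ e) m (f ∘ e) :=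
  ⟨h.1.comp e.surjective, fun k => (binLoad_comp_equiv e size f k).trans_le (h.2 k)⟩

theorem IsSSPacking.comp_equiv {ι κ : Type*} [Fintype ι] [Fintype κ] (e : κ ≃ ι) {size : ι → ℝ}
    {m : ℕ} {f : ι → Fin m} (h : IsSSPacking size m f) : IsSSPacking (size ∘ e) m (f ∘ e) := by
  refine ⟨h.1.comp_equiv e, fun k S hS hsum => ?_⟩
  have hmap : ∑ i ∈ S.map e.toEmbedding, size i = ∑ i ∈ S, (size ∘ e) i := by
    simp [Finset.sum_map]
  rw [binLoad_comp_equiv, ← hmap]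
  refine h.2 k _ (fun i hi => ?_) (hmap.trans_le hsum)
  obtain ⟨j, hj, rfl⟩ := Finset.mem_map.1 hi
  exact hS j hj

/-- A set of `q * d` elements maps to `q` elements with all fibers of size `d`. -/
theorem exists_equitable_map {n q d : ℕ} (h : n = q * d) :
    ∃ φ : Fin n → Fin q, ∀ b, (Finset.univ.filter fun t => φ t = b).card = d := by
  subst h
  refine ⟨fun t => (finProdFinEquiv.symm t).1, fun b => ?_⟩
  rw [Finset.card_filter,
    Equiv.sum_comp finProdFinEquiv.symm fun x : Fin q × Fin d => if x.1 = b then 1 else 0,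
    Fintype.sum_prod_type]
  simp [apply_ite Finset.card]

/-- Split each of `K` levels, of `n` items each, into `q k` groups of `d k` items, and number the
groups so that higher levels come first. -/
theorem exists_antitone_grouping {K n : ℕ} (q d : Fin K → ℕ) (h : ∀ k, n = q k * d k) :
    ∃ (lev : Fin (∑ k, q k) → Fin K) (f : Fin K × Fin n → Fin (∑ k, q k)),
      Antitone lev ∧ (∀ p, lev (f p) = p.1) ∧
      ∀ b, (Finset.univ.filter fun p => f p = b).card = d (lev b) := by
  choose φ hφ using fun k => exists_equitable_map (h k)
  let e : Fin (∑ k, q k) ≃ (Σ k, Fin (q k)) := finSigmaFinEquiv.symm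
  let σ := Tuple.sort fun b => OrderDual.toDual (e b).1
  have hσ : Monotone ((fun b => OrderDual.toDual (e b).1) ∘ σ) := Tuple.monotone_sort _
  let e' : Fin (∑ k, q k) ≃ (Σ k, Fin (q k)) := σ.trans e
  refine ⟨fun b => (e' b).1, fun p => e'.symm ⟨p.1, φ p.1 p.2⟩, fun a b hab => hσ hab,
    fun p => by simp, fun b => ?_⟩
  obtain ⟨⟨k, c⟩, rfl⟩ := e'.symm.surjective b
  simp only [Equiv.apply_symm_apply, EmbeddingLike.apply_eq_iff_eq]
  rw [← hφ k c, ← Finset.card_map (Function.Embedding.sectR k (Fin n))]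
  congr 1
  ext ⟨k', t⟩
  simp only [Finset.mem_filter, Finset.mem_univ, true_and, Finset.mem_map,
    Function.Embedding.sectR_apply, Prod.mk.injEq, Sigma.mk.injEq]
  constructor
  · rintro ⟨rfl, ht⟩
    exact ⟨t, eq_of_heq ht, rfl, rfl⟩
  · rintro ⟨t', ht, rfl, rfl⟩
    exact ⟨rfl, heq_of_eq ht⟩

/-- Among items of sizes `2⁻¹ ^ (j + 1) + ε` with `j ≤ k`, no feasible set beats `2 ^ (k + 1) - 1`
items of the smallest size. -/
theorem sum_half_pow_add_le {ι : Type*} (S : Finset ι) (l : ι → ℕ) (k : ℕ) {ε : ℝ} (hε : 0 < ε)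
    (hl : ∀ i ∈ S, l i ≤ k) (hS : ∑ i ∈ S, ((1 / 2 : ℝ) ^ (l i + 1) + ε) ≤ 1) :
    ∑ i ∈ S, ((1 / 2 : ℝ) ^ (l i + 1) + ε) ≤
      ((2 ^ (k + 1) - 1 : ℕ) : ℝ) * ((1 / 2) ^ (k + 1) + ε) := by
  rcases S.eq_empty_or_nonempty with rfl | hne
  · simp only [Finset.sum_empty]; positivity
  set U : ℕ := ∑ i ∈ S, 2 ^ (k - l i) with hU
  have hcard : S.card ≤ U := by
    rw [Finset.card_eq_sum_ones]
    exact Finset.sum_le_sum fun i _ => Nat.one_le_two_pow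
  have hsum : ∑ i ∈ S, ((1 / 2 : ℝ) ^ (l i + 1) + ε) = U * (1 / 2) ^ (k + 1) + S.card * ε := by
    rw [Finset.sum_add_distrib, Finset.sum_const, nsmul_eq_mul, hU, Nat.cast_sum, Finset.sum_mul]
    congr 1
    refine Finset.sum_congr rfl fun i hi => ?_
    have hk : k + 1 = (k - l i) + (l i + 1) := by have := hl i hi; omega
    rw [hk, pow_add (1 / 2 : ℝ) (k - l i), ← mul_assoc]
    push_cast
    rw [← mul_pow]
    norm_num
  rw [hsum] at hS ⊢
  have hpos : 0 < (S.card : ℝ) * ε := mul_pos (by exact_mod_cast hne.card_pos) hε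
  have hlt : (U : ℝ) < 2 ^ (k + 1) := by
    have h1 : (U : ℝ) * (1 / 2) ^ (k + 1) < 1 := by linarith
    rwa [one_div, inv_pow, ← div_eq_mul_inv, div_lt_one (by positivity)] at h1
  have hlt' : U < 2 ^ (k + 1) := by exact_mod_cast hlt
  have hle : U ≤ 2 ^ (k + 1) - 1 := by omega
  rw [mul_add]
  gcongr
  exact hcard.trans hle

/-- With `n` divisible by all `2 ^ (i + 1) - 1`, `i < K`, the instance with `n` items of each size
`2⁻¹ ^ (i + 1) + 4⁻¹ ^ K` packs into `n` bins, but also admits an SS packing with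
`n / (2 ^ (i + 1) - 1)` bins for each `i`. -/
theorem exists_ssPacking_of_dvd {K n : ℕ} (hK : 0 < K) (q : Fin K → ℕ)
    (h : ∀ k, n = q k * (2 ^ (k.1 + 1) - 1)) :
    ∃ (N : ℕ) (size : Fin N → ℝ) (f : Fin N → Fin (∑ k, q k)) (g : Fin N → Fin n),
      (∀ i, size i ∈ Set.Ioc (0 : ℝ) 1) ∧ IsSSPacking size (∑ k, q k) f ∧
        IsPacking size n g := by
  obtain ⟨lev, f, hanti, hlev, hcard⟩ := exists_antitone_grouping q _ h
  set ε : ℝ := (1 / 4) ^ K with hε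
  have hεpos : 0 < ε := by positivity
  have hsq : ε = (1 / 2) ^ K * (1 / 2) ^ K := by rw [hε, ← mul_pow]; norm_num
  have hhalf : ((2 : ℝ) ^ K) * (1 / 2) ^ K = 1 := by rw [← mul_pow]; norm_num
  let size : Fin K × Fin n → ℝ := fun p => (1 / 2) ^ (p.1.1 + 1) + ε
  have hbound (k : Fin K) :
      ((2 ^ (k.1 + 1) - 1 : ℕ) : ℝ) * ((1 / 2) ^ (k.1 + 1) + ε) ≤ 1 := by
    have h2 : ((2 ^ (k.1 + 1) - 1 : ℕ) : ℝ) = 2 ^ (k.1 + 1) - 1 := by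
      rw [Nat.cast_sub Nat.one_le_two_pow]; norm_num
    have h3 : (2 : ℝ) ^ (k.1 + 1) * (1 / 2) ^ (k.1 + 1) = 1 := by rw [← mul_pow]; norm_num
    have h4 : (2 : ℝ) ^ (k.1 + 1) ≤ 2 ^ K := pow_le_pow_right₀ (by norm_num) k.2
    have h5 : ((1 : ℝ) / 2) ^ K ≤ (1 / 2) ^ (k.1 + 1) :=
      pow_le_pow_of_le_one (by norm_num) (by norm_num) k.2
    have h6 : (2 : ℝ) ^ (k.1 + 1) * ε ≤ 2 ^ K * ε := mul_le_mul_of_nonneg_right h4 hεpos.le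
    have h7 : (2 : ℝ) ^ K * ε = (1 / 2) ^ K := by rw [hsq, ← mul_assoc, hhalf, one_mul]
    rw [h2]
    nlinarith
  have hload (b) : binLoad size f b =
      ((2 ^ ((lev b).1 + 1) - 1 : ℕ) : ℝ) * ((1 / 2) ^ ((lev b).1 + 1) + ε) := by
    unfold binLoad
    rw [Finset.sum_congr rfl (g := fun _ => (1 / 2 : ℝ) ^ ((lev b).1 + 1) + ε), Finset.sum_const,
      hcard, nsmul_eq_mul]
    intro p hp
    rw [← (Finset.mem_filter.1 hp).2, hlev]
  have hss : IsSSPacking size (∑ k, q k) f := by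
    refine ⟨⟨fun b => ?_, fun b => (hload b).trans_le (hbound _)⟩, fun b S hS hsum => ?_⟩
    · have : 0 < (Finset.univ.filter fun p => f p = b).card := by
        rw [hcard]
        have := Nat.one_lt_two_pow (n := (lev b).1 + 1) (by omega)
        omega
      obtain ⟨p, hp⟩ := Finset.card_pos.1 this
      exact ⟨p, (Finset.mem_filter.1 hp).2⟩
    · rw [hload]
      refine sum_half_pow_add_le S (fun p => p.1.1) _ hεpos (fun p hp => ?_) hsum
      have := hanti (hS p hp)
      rwa [hlev] at this
  have hpack : IsPacking size n Prod.snd := by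
    refine ⟨fun t => ⟨(⟨0, hK⟩, t), rfl⟩, fun t => ?_⟩
    have hsum : binLoad size Prod.snd t = ∑ k : Fin K, ((1 / 2 : ℝ) ^ (k.1 + 1) + ε) := by
      unfold binLoad
      rw [Finset.sum_filter, Fintype.sum_prod_type]
      simp [size]
    have hgeom (m : ℕ) : ∑ k ∈ Finset.range m, (1 / 2 : ℝ) ^ (k + 1) = 1 - (1 / 2) ^ m := by
      induction m with
      | zero => simp
      | succ m ih => rw [Finset.sum_range_succ, ih]; ring
    have hKε : (K : ℝ) * ε ≤ (1 / 2) ^ K := by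
      have : (K : ℝ) ≤ 2 ^ K := by exact_mod_cast Nat.lt_two_pow_self.le
      calc (K : ℝ) * ε ≤ 2 ^ K * ε := by gcongr
        _ = (1 / 2) ^ K := by rw [hsq, ← mul_assoc, hhalf, one_mul]
    rw [hsum, Finset.sum_add_distrib, Fin.sum_univ_eq_sum_range fun k => (1 / 2 : ℝ) ^ (k + 1),
      hgeom, Finset.sum_const, Finset.card_univ, Fintype.card_fin, nsmul_eq_mul]
    linarith
  refine ⟨K * n, size ∘ finProdFinEquiv.symm, f ∘ finProdFinEquiv.symm,
    Prod.snd ∘ finProdFinEquiv.symm, fun i => ⟨by simp only [size, Function.comp]; positivity, ?_⟩,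
    hss.comp_equiv _, hpack.comp_equiv _⟩
  have := hpack.2 (finProdFinEquiv.symm i).2
  refine le_trans ?_ this
  unfold binLoad
  exact Finset.single_le_sum (f := size) (fun p _ => by simp only [size]; positivity)
    (Finset.mem_filter.2 ⟨Finset.mem_univ _, rfl⟩)

theorem summable_one_div_two_pow_sub_one :
    Summable fun i : ℕ => 1 / ((2 : ℝ) ^ (i + 1) - 1) := by
  refine Summable.of_nonneg_of_le (fun i => ?_) (fun i => ?_) summable_geometric_two
  · have : (1 : ℝ) ≤ 2 ^ (i + 1) := one_le_pow₀ (by norm_num)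
    exact one_div_nonneg.2 (by linarith)
  · have : (1 : ℝ) ≤ 2 ^ i := one_le_pow₀ (by norm_num)
    rw [one_div_pow]
    exact one_div_le_one_div_of_le (by positivity) (by rw [pow_succ]; linarith)

/-- Lower bound on the Subset Sum algorithm: for every `δ > 0` there is an instance,
an SS packing of it into `m` bins and a packing into `n` bins with
`m ≥ (λ - δ)·n`, where `λ = ∑_{i=1}^∞ 1/(2^i - 1)`. -/
theorem ssPacking_lower_bound (δ : ℝ) (hδ : 0 < δ) :
    ∃ (N m n : ℕ) (size : Fin N → ℝ) (f : Fin N → Fin m) (g : Fin N → Fin n),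
      (∀ i, size i ∈ Set.Ioc (0 : ℝ) 1) ∧ IsSSPacking size m f ∧ IsPacking size n g ∧
      ((∑' i : ℕ, 1 / ((2 : ℝ) ^ (i + 1) - 1)) - δ) * n ≤ (m : ℝ) := by
  obtain ⟨K, hsumK, hK⟩ :=
    ((summable_one_div_two_pow_sub_one.hasSum.tendsto_sum_nat.eventually
      (lt_mem_nhds (sub_lt_self _ hδ))).and (Filter.eventually_gt_atTop 0)).exists
  let n : ℕ := ∏ k : Fin K, (2 ^ (k.1 + 1) - 1)
  let q : Fin K → ℕ := fun k => n / (2 ^ (k.1 + 1) - 1)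
  have hq (k : Fin K) : n = q k * (2 ^ (k.1 + 1) - 1) :=
    (Nat.div_mul_cancel (Finset.dvd_prod_of_mem (fun k : Fin K => 2 ^ (k.1 + 1) - 1)
      (Finset.mem_univ k))).symm
  obtain ⟨N, size, f, g, hsize, hf, hg⟩ := exists_ssPacking_of_dvd hK q hq
  refine ⟨N, _, n, size, f, g, hsize, hf, hg, ?_⟩
  refine (mul_le_mul_of_nonneg_right hsumK.le n.cast_nonneg).trans_eq ?_
  rw [← Fin.sum_univ_eq_sum_range fun i => 1 / ((2 : ℝ) ^ (i + 1) - 1), Finset.sum_mul,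
    Nat.cast_sum]
  refine Finset.sum_congr rfl fun k _ => ?_
  have h1 : (1 : ℝ) < 2 ^ (k.1 + 1) := one_lt_pow₀ (by norm_num) (by omega)
  have h2 : (n : ℝ) = q k * (2 ^ (k.1 + 1) - 1) := by
    conv_lhs => rw [hq k]
    rw [Nat.cast_mul, Nat.cast_sub Nat.one_le_two_pow]
    norm_num
  rw [h2, one_div, mul_comm, mul_inv_cancel_right₀ (by linarith)]
end

section
/- Let t ≥ 2 and r ≥ t be integers. For a vector s = (s_1, …, s_r) of reals with s_i ≥ 0 for all i, s_i ≤ 1/t for all i < r, and s_1 + … + s_r ≤ 1, define F^t(s) = ∑_{i=1}^r s_i / max( ∑_{j=1}^i s_j , 1 − min_{1 ≤ j ≤ i} s_j , t/(t+1) ). Then F^t(s) ≤ max_{x ∈ [1/(t+1), 1/t]} λ^t_r(x), where λ^t_r(x) = x·(t−1)·(t+1)/t + ∑_{i=1}^{r−t} 1/( 2^i/(1 − (t−1)x) − 1 ) + (1 − (t−1)x)/2^{r−t}. Equivalently, an optimal solution of this mathematical program has the form s*_i = x for i < t, s*_i = (1 − x(t−1))/2^{i−t+1} for t ≤ i < r,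 and s*_r = (1 − x(t−1))/2^{r−t}, for some x ∈ [1/(t+1), 1/t]. -/
/-- The objective function of the parametric mathematical program (MP_r^t):
`F^t(s) = ∑_{i=1}^r s_i / max(∑_{j=1}^i s_j, 1 - min_{1 ≤ j ≤ i} s_j, t/(t+1))`
(0-based indices). -/
noncomputable def ssObjT (t r : ℕ) (s : Fin r → ℝ) : ℝ :=
  ∑ i : Fin r, s i /
    max (max (∑ j ∈ Finset.Iic i, s j)
             (1 - (Finset.Iic i).inf' ⟨i, Finset.mem_Iic.mpr le_rfl⟩ s))
        ((t : ℝ) / ((t : ℝ) + 1))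

/-- `λ^t_r(x) = x(t-1)(t+1)/t + ∑_{i=1}^{r-t} 1/(2^i/(1-(t-1)x) - 1)
 + (1-(t-1)x)/2^{r-t}`, the value of the solution of (MP_r^t) induced by `x`. -/
noncomputable def lamTR (t r : ℕ) (x : ℝ) : ℝ :=
  x * ((t : ℝ) - 1) * ((t : ℝ) + 1) / t
    + ∑ i ∈ Finset.range (r - t), 1 / ((2 : ℝ) ^ (i + 1) / (1 - ((t : ℝ) - 1) * x) - 1)
    + (1 - ((t : ℝ) - 1) * x) / 2 ^ (r - t)

/-- The value `∑_{i=1}^{n-1} 1 / (2^i / w - 1) + w / 2^{n-1}` of halving the remaining capacity `w`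
with each of `n` items, the last item filling the bin; it is `0` when there are no items. -/
noncomputable def halvingValue : ℕ → ℝ → ℝ
  | 0, _ => 0
  | 1, w => w
  | n + 2, w => w / (2 - w) + halvingValue (n + 1) (w / 2)

theorem halvingValue_succ_eq (n : ℕ) {w : ℝ} (hw : w ≠ 0) :
    halvingValue (n + 1) w =
      ∑ i ∈ Finset.range n, 1 / ((2 : ℝ) ^ (i + 1) / w - 1) + w / 2 ^ n := by
  induction n generalizing w with
  | zero => simp [halvingValue]
  | succ n ih =>
    have h0 : w / (2 - w) = 1 / ((2 : ℝ) ^ (0 + 1) / w - 1) := by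
      rw [zero_add, pow_one, div_sub_one hw, one_div_div]
    have hs : ∀ i : ℕ, (2 : ℝ) ^ (i + 1) / (w / 2) = 2 ^ (i + 1 + 1) / w := by
      intro i
      field_simp
      ring
    rw [halvingValue, ih (div_ne_zero hw two_ne_zero), Finset.sum_range_succ', h0]
    simp only [hs]
    rw [pow_succ]
    field_simp
    ring

theorem halvingValue_le_succ (n : ℕ) {w : ℝ} (hw : 0 ≤ w) (hw1 : w ≤ 1) :
    halvingValue n w ≤ halvingValue (n + 1) w := by
  induction n, w using halvingValue.induct with
  | case1 => exact hw
  | case2 w =>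
    have : w / 2 ≤ w / (2 - w) := div_le_div_of_nonneg_left hw (by linarith) (by linarith)
    simp only [halvingValue]
    linarith
  | case3 n w ih =>
    exact add_le_add le_rfl (ih (by linarith) (by linarith))

theorem sub_le_halvingValue_sub (n : ℕ) {u v : ℝ} (hu : 0 ≤ u) (huv : u ≤ v) (hv : v ≤ 1) :
    v - u ≤ halvingValue (n + 1) v - halvingValue (n + 1) u := by
  induction n generalizing u v with
  | zero => exact le_rfl
  | succ n ih =>
    have h := @ih (u / 2) (v / 2) (by linarith) (by linarith) (by linarith)
    have h2 : (v - u) / 2 ≤ v / (2 - v) - u / (2 - u) := by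
      have hv2 : 0 < 2 - v := by linarith
      have hu2 : 0 < 2 - u := by linarith
      rw [div_sub_div _ _ hv2.ne' hu2.ne', div_le_div_iff₀ two_pos (mul_pos hv2 hu2)]
      nlinarith [mul_nonneg (sub_nonneg.2 huv) (by nlinarith : 0 ≤ 4 - (2 - v) * (2 - u))]
    simp only [halvingValue]
    linarith

theorem convexOn_halvingValue (n : ℕ) : ConvexOn ℝ (Set.Icc 0 1) (halvingValue n) := by
  refine ⟨convex_Icc 0 1, ?_⟩
  rintro x ⟨hx, hx1⟩ y ⟨hy, hy1⟩ a b ha hb hab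
  simp only [smul_eq_mul]
  rcases n with _ | n
  · simp [halvingValue]
  induction n generalizing x y with
  | zero => exact le_rfl
  | succ n ih =>
    have h := @ih (x / 2) (by linarith) (by linarith) (y / 2) (by linarith) (by linarith)
    rw [show a * (x / 2) + b * (y / 2) = (a * x + b * y) / 2 by ring] at h
    have h2 : (a * x + b * y) / (2 - (a * x + b * y)) ≤ a * (x / (2 - x)) + b * (y / (2 - y)) := by
      have hx2 : 0 < 2 - x := by linarith
      have hy2 : 0 < 2 - y := by linarith
      obtain rfl : b = 1 - a := by linarith
      have hz2 : 0 < 2 - (a * x + (1 - a) * y) := by nlinarith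
      have key : a * (x / (2 - x)) + (1 - a) * (y / (2 - y))
          - (a * x + (1 - a) * y) / (2 - (a * x + (1 - a) * y))
          = 2 * (a * (1 - a) * (x - y) ^ 2)
            / ((2 - x) * (2 - y) * (2 - (a * x + (1 - a) * y))) := by
        field_simp
        ring
      have : 0 ≤ 2 * (a * (1 - a) * (x - y) ^ 2)
            / ((2 - x) * (2 - y) * (2 - (a * x + (1 - a) * y))) := by positivity
      linarith
    simp only [halvingValue]
    linarith

/-- Halving is the best first choice when an item of size `s`, placed into remaining capacity `w`,
is charged at least `max (1 - w + s) (1 - w / 2)`. -/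
theorem div_add_halvingValue_le (n : ℕ) {w s d : ℝ} (hs : 0 ≤ s) (hsw : s ≤ w) (hw : w ≤ 1)
    (hd : 1 - w + s ≤ d) (hd' : 1 - w / 2 ≤ d) :
    s / d + halvingValue n (w - s) ≤ halvingValue (n + 1) w := by
  have hd0 : 0 < d := by linarith
  cases n with
  | zero =>
    simp only [halvingValue, add_zero]
    rw [div_le_iff₀ hd0]
    nlinarith [mul_nonneg (sub_nonneg.2 hsw) (sub_nonneg.2 hw),
      mul_le_mul_of_nonneg_left hd (hs.trans hsw)]
  | succ n =>
    rcases le_total s (w / 2) with h | h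
    · rcases (hs.trans hsw).eq_or_lt with rfl | hw0
      · obtain rfl : s = 0 := le_antisymm hsw hs
        simpa using halvingValue_le_succ (n + 1) le_rfl hw
      · have hmem : w ∈ Set.Icc (0 : ℝ) 1 := ⟨hw0.le, hw⟩
        have hmem' : w / 2 ∈ Set.Icc (0 : ℝ) 1 := ⟨by linarith, by linarith⟩
        have hθ : 0 ≤ 1 - s / (w / 2) := sub_nonneg.2 ((div_le_one (by linarith)).2 h)
        have hc := (convexOn_halvingValue (n + 1)).2 hmem hmem' hθ
          (by positivity : 0 ≤ s / (w / 2)) (by ring)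
        simp only [smul_eq_mul] at hc
        rw [show (1 - s / (w / 2)) * w + s / (w / 2) * (w / 2) = w - s by field_simp; ring] at hc
        have hm := mul_le_mul_of_nonneg_left (halvingValue_le_succ (n + 1) hw0.le hw) hθ
        have h1 : s / d ≤ s / (w / 2) * (w / (2 - w)) := by
          rw [show s / (w / 2) * (w / (2 - w)) = s / (1 - w / 2) by
            have : 2 - w ≠ 0 := by linarith
            have : 1 - w / 2 ≠ 0 := by linarith
            field_simp]
          exact div_le_div_of_nonneg_left hs (by linarith) hd'
        have hr : halvingValue (n + 1 + 1) w = w / (2 - w) + halvingValue (n + 1) (w / 2) := rfl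
        rw [hr] at hm ⊢
        linarith
    · have hslope := sub_le_halvingValue_sub n (u := w - s) (v := w / 2) (by linarith)
        (by linarith) (by linarith)
      have h1 : s / d ≤ s / (1 - w + s) := div_le_div_of_nonneg_left hs (by linarith) hd
      have h2 : s / (1 - w + s) - w / (2 - w) ≤ w / 2 - (w - s) := by
        have ha : 0 < 1 - w + s := by linarith
        have hb : 0 < 2 - w := by linarith
        rw [div_sub_div _ _ ha.ne' hb.ne', div_le_iff₀ (mul_pos ha hb)]
        nlinarith [mul_nonneg (sub_nonneg.2 h) (mul_nonneg (sub_nonneg.2 h) hb.le),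
          mul_nonneg (sub_nonneg.2 h) (sq_nonneg w)]
      simp only [halvingValue]
      linarith

section Sequences

variable {a d : ℕ → ℝ} {r : ℕ}

theorem sum_Ico_div_le_halvingValue (ha : ∀ i, 0 ≤ a i) (hsum : ∑ i ∈ Finset.range r, a i ≤ 1)
    (hd : ∀ i < r, ∑ j ∈ Finset.range (i + 1), a j ≤ d i) (hd' : ∀ i < r, 1 - a i ≤ d i)
    (n k : ℕ) (hk : k + n = r) :
    ∑ i ∈ Finset.Ico k r, a i / d i ≤ halvingValue n (1 - ∑ i ∈ Finset.range k, a i) := by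
  induction n generalizing k with
  | zero => simp [← hk, halvingValue]
  | succ n ih =>
    have hkr : k < r := by omega
    have h1 := hd k hkr
    have h2 := hd' k hkr
    have hmono : ∑ i ∈ Finset.range (k + 1), a i ≤ ∑ i ∈ Finset.range r, a i :=
      Finset.sum_le_sum_of_subset_of_nonneg (Finset.range_mono hkr) fun i _ _ => ha i
    have hnn : 0 ≤ ∑ i ∈ Finset.range k, a i := Finset.sum_nonneg fun i _ => ha i
    have h := ih (k + 1) (by omega)
    rw [Finset.sum_range_succ] at h h1 hmono
    rw [Finset.sum_eq_sum_Ico_succ_bot hkr]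
    have := div_add_halvingValue_le n (w := 1 - ∑ i ∈ Finset.range k, a i) (s := a k) (d := d k)
      (ha k) (by linarith) (by linarith) (by linarith) (by linarith)
    rw [sub_sub] at this
    linarith

/-- If the current load is at most `1 - w` and all weights are at least `1 - w / 2`, then the
remaining value is at most that of filling up to `1 - w` at weight `1 - w / 2` and then halving. -/
theorem sum_Ico_div_le_of_load_le {w : ℝ} (hw : 0 ≤ w) (hw1 : w ≤ 1)
    (ha : ∀ i, 0 ≤ a i) (hsum : ∑ i ∈ Finset.range r, a i ≤ 1)
    (hd : ∀ i < r, ∑ j ∈ Finset.range (i + 1), a j ≤ d i) (hd' : ∀ i < r, 1 - a i ≤ d i)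
    (hdw : ∀ i < r, 1 - w / 2 ≤ d i)
    (n k : ℕ) (hk : k + n = r) (hload : ∑ i ∈ Finset.range k, a i ≤ 1 - w) :
    ∑ i ∈ Finset.Ico k r, a i / d i ≤
      (1 - w - ∑ i ∈ Finset.range k, a i) / (1 - w / 2) + halvingValue n w := by
  induction n generalizing k with
  | zero =>
    simp only [← hk, add_zero, Finset.Ico_self, Finset.sum_empty, halvingValue]
    exact div_nonneg (by linarith) (by linarith)
  | succ n ih =>
    have hkr : k < r := by omega
    have h1 := hd k hkr
    have h3 := hdw k hkr
    have hc : 0 < 1 - w / 2 := by linarith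
    have hmono : ∑ i ∈ Finset.range (k + 1), a i ≤ ∑ i ∈ Finset.range r, a i :=
      Finset.sum_le_sum_of_subset_of_nonneg (Finset.range_mono hkr) fun i _ _ => ha i
    rw [Finset.sum_eq_sum_Ico_succ_bot hkr]
    rcases le_or_gt (∑ i ∈ Finset.range (k + 1), a i) (1 - w) with hle | hgt
    · have h := ih (k + 1) (by omega) hle
      have hstep := halvingValue_le_succ n hw hw1
      have hak : a k / d k ≤ a k / (1 - w / 2) := div_le_div_of_nonneg_left (ha k) hc h3
      rw [Finset.sum_range_succ, ← sub_sub, sub_div] at h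
      linarith
    · have htail := sum_Ico_div_le_halvingValue ha hsum hd hd' n (k + 1) (by omega)
      rw [Finset.sum_range_succ] at htail h1 hmono hgt
      set S := ∑ i ∈ Finset.range k, a i
      have hstep := div_add_halvingValue_le n (w := w) (s := S + a k - (1 - w)) (d := d k)
        (by linarith) (by linarith) hw1 (by linarith) h3
      rw [show w - (S + a k - (1 - w)) = 1 - (S + a k) by ring] at hstep
      have hhead : (1 - w - S) / d k ≤ (1 - w - S) / (1 - w / 2) :=
        div_le_div_of_nonneg_left (by linarith) hc h3
      have hsplit : a k / d k = (1 - w - S) / d k + (S + a k - (1 - w)) / d k := by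
        rw [← add_div]
        ring
      linarith

end Sequences

theorem lamTR_eq (t r : ℕ) {x : ℝ} (hx : 1 - ((t : ℝ) - 1) * x ≠ 0) :
    lamTR t r x = x * ((t : ℝ) - 1) * ((t : ℝ) + 1) / t
      + halvingValue (r - t + 1) (1 - ((t : ℝ) - 1) * x) := by
  rw [lamTR, halvingValue_succ_eq _ hx, add_assoc]

theorem exists_sum_range_div_le_lamTR {t r : ℕ} (ht : 2 ≤ t) (hr : t ≤ r) {a d : ℕ → ℝ}
    (ha : ∀ i, 0 ≤ a i) (hub : ∀ i < r - 1, a i ≤ 1 / (t : ℝ))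
    (hsum : ∑ i ∈ Finset.range r, a i ≤ 1)
    (hd : ∀ i < r, ∑ j ∈ Finset.range (i + 1), a j ≤ d i) (hd' : ∀ i < r, 1 - a i ≤ d i)
    (hdt : ∀ i < r, (t : ℝ) / ((t : ℝ) + 1) ≤ d i) :
    ∃ x ∈ Set.Icc (1 / ((t : ℝ) + 1)) (1 / (t : ℝ)),
      ∑ i ∈ Finset.range r, a i / d i ≤ lamTR t r x := by
  have ht2 : (2 : ℝ) ≤ t := by exact_mod_cast ht
  have ht0 : (0 : ℝ) < t := by linarith
  have ht1 : (0 : ℝ) < (t : ℝ) - 1 := by linarith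
  have hcast : ((t - 1 : ℕ) : ℝ) = (t : ℝ) - 1 := by
    rw [Nat.cast_sub (by omega), Nat.cast_one]
  set S := ∑ i ∈ Finset.range (t - 1), a i with hS
  have hhead : ∑ i ∈ Finset.range (t - 1), a i / d i ≤ S * (((t : ℝ) + 1) / t) := by
    rw [hS, Finset.sum_mul]
    refine Finset.sum_le_sum fun i hi => ?_
    rw [← mul_div_assoc, ← div_div_eq_mul_div]
    exact div_le_div_of_nonneg_left (ha i) (by positivity)
      (hdt i (by have := Finset.mem_range.1 hi; omega))
  have hSub : S ≤ ((t : ℝ) - 1) / t := by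
    have := Finset.sum_le_card_nsmul (Finset.range (t - 1)) a (1 / (t : ℝ)) fun i hi =>
      hub i (by have := Finset.mem_range.1 hi; omega)
    rwa [Finset.card_range, nsmul_eq_mul, hcast, mul_one_div] at this
  rw [← Finset.sum_range_add_sum_Ico _ (by omega : t - 1 ≤ r)]
  rcases le_total (((t : ℝ) - 1) / ((t : ℝ) + 1)) S with hle | hle
  · refine ⟨S / ((t : ℝ) - 1), ⟨?_, ?_⟩, ?_⟩
    · rw [le_div_iff₀ ht1]
      rwa [one_div_mul_eq_div]
    · rw [div_le_iff₀ ht1]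
      rwa [one_div_mul_eq_div]
    · have hx : ((t : ℝ) - 1) * (S / ((t : ℝ) - 1)) = S := mul_div_cancel₀ S ht1.ne'
      have hS1 : S < 1 := hSub.trans_lt ((div_lt_one ht0).2 (by linarith))
      have htail := sum_Ico_div_le_halvingValue ha hsum hd hd' (r - t + 1) (t - 1) (by omega)
      rw [lamTR_eq t r (by rw [hx]; linarith), hx, div_mul_cancel₀ S ht1.ne', mul_div_assoc]
      exact add_le_add hhead htail
  · refine ⟨1 / ((t : ℝ) + 1), ⟨le_rfl, one_div_le_one_div_of_le ht0 (by linarith)⟩, ?_⟩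
    have hw : 1 - ((t : ℝ) - 1) * (1 / ((t : ℝ) + 1)) = 2 / ((t : ℝ) + 1) := by
      field_simp
      ring
    have hw2 : 1 - 2 / ((t : ℝ) + 1) / 2 = (t : ℝ) / ((t : ℝ) + 1) := by
      field_simp
      ring
    have hw1 : 1 - 2 / ((t : ℝ) + 1) = ((t : ℝ) - 1) / ((t : ℝ) + 1) := by
      field_simp
      ring
    have hpos : 0 < 2 / ((t : ℝ) + 1) := by positivity
    have htail := sum_Ico_div_le_of_load_le hpos.le
      ((div_le_one (by linarith)).2 (by linarith)) ha hsum hd hd'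
      (fun i hi => hw2 ▸ hdt i hi) (r - t + 1) (t - 1) (by omega) (hw1 ▸ hle)
    rw [lamTR_eq t r (by rw [hw]; exact hpos.ne'), hw]
    rw [hw2, hw1, ← hS] at htail
    have hval : S * (((t : ℝ) + 1) / t)
        + (((t : ℝ) - 1) / ((t : ℝ) + 1) - S) / ((t : ℝ) / ((t : ℝ) + 1))
        = 1 / ((t : ℝ) + 1) * ((t : ℝ) - 1) * ((t : ℝ) + 1) / t := by
      field_simp
      ring
    linarith

/-- Every feasible solution of the parametric program (MP_r^t) has value at most
`max_{x ∈ [1/(t+1), 1/t]} λ^t_r(x)`. -/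
theorem ssObjT_le_max (t r : ℕ) (ht : 2 ≤ t) (hr : t ≤ r) (s : Fin r → ℝ)
    (hpos : ∀ i, 0 ≤ s i)
    (hub : ∀ i : Fin r, (i : ℕ) < r - 1 → s i ≤ 1 / (t : ℝ))
    (hsum : ∑ i, s i ≤ 1) :
    ∃ x ∈ Set.Icc (1 / ((t : ℝ) + 1)) (1 / (t : ℝ)), ssObjT t r s ≤ lamTR t r x := by
  set D : Fin r → ℝ := fun i =>
    max (max (∑ j ∈ Finset.Iic i, s j)
             (1 - (Finset.Iic i).inf' ⟨i, Finset.mem_Iic.mpr le_rfl⟩ s))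
        ((t : ℝ) / ((t : ℝ) + 1)) with hD
  set a : ℕ → ℝ := fun i => if h : i < r then s ⟨i, h⟩ else 0 with ha
  set d : ℕ → ℝ := fun i => if h : i < r then D ⟨i, h⟩ else 0 with hd
  have haFin : ∀ i : Fin r, a i = s i := fun i => by simp [ha]
  have hdFin : ∀ i : Fin r, d i = D i := fun i => by simp [hd]
  have hobj : ssObjT t r s = ∑ i ∈ Finset.range r, a i / d i := by
    rw [Finset.sum_range]
    simp only [haFin, hdFin]
    rfl
  have hprefix : ∀ i : Fin r, ∑ j ∈ Finset.range (i + 1), a j = ∑ j ∈ Finset.Iic i, s j := by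
    intro i
    rw [show Finset.range ((i : ℕ) + 1) = (Finset.Iic i).map Fin.valEmbedding by
      rw [Fin.map_valEmbedding_Iic]
      ext j
      simp, Finset.sum_map]
    exact Finset.sum_congr rfl fun j _ => haFin j
  rw [hobj]
  refine exists_sum_range_div_le_lamTR ht hr ?_ ?_ ?_ ?_ ?_ ?_
  · intro i
    by_cases h : i < r
    · exact haFin ⟨i, h⟩ ▸ hpos _
    · simp [ha, h]
  · intro i hi
    exact haFin ⟨i, by omega⟩ ▸ hub ⟨i, by omega⟩ hi
  · rw [Finset.sum_range]
    simpa only [haFin] using hsum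
  · intro i hi
    rw [hprefix ⟨i, hi⟩, hdFin ⟨i, hi⟩]
    exact (le_max_left _ _).trans (le_max_left _ _)
  · intro i hi
    rw [haFin ⟨i, hi⟩, hdFin ⟨i, hi⟩]
    exact (sub_le_sub_left (Finset.inf'_le s (Finset.mem_Iic.2 le_rfl)) 1).trans
      ((le_max_right _ _).trans (le_max_left _ _))
  · intro i hi
    rw [hdFin ⟨i, hi⟩]
    exact le_max_right _ _
end

section
/- Let t ≥ 2 be an integer and define λ^t(x) = x·(t−1)·(t+1)/t + ∑_{i=1}^∞ 1/( 2^i/(1 − (t−1)x) − 1 ). Then for every x in the interval [1/(t+1), 1/t], λ^t(x) ≤ λ^t(1/(t+1)); that is, λ^t attains its maximum on [1/(t+1), 1/t] at x = 1/(t+1). -/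
/-- `λ^t(x) = x·(t-1)·(t+1)/t + ∑_{i=1}^∞ 1/(2^i/(1-(t-1)x) - 1)`. -/
noncomputable def lamT (t : ℕ) (x : ℝ) : ℝ :=
  x * ((t : ℝ) - 1) * ((t : ℝ) + 1) / t
    + ∑' i : ℕ, 1 / ((2 : ℝ) ^ (i + 1) / (1 - ((t : ℝ) - 1) * x) - 1)

lemma one_div_two_pow_div_sub_one (i : ℕ) {y : ℝ} (hy : 0 < y) :
    1 / ((2 : ℝ) ^ (i + 1) / y - 1) = y * (1 / 2) ^ (i + 1) / (1 - y * (1 / 2) ^ (i + 1)) := by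
  have h2 : (0 : ℝ) < 2 ^ (i + 1) := by positivity
  rw [div_pow, one_pow, div_sub_one hy.ne', one_div_div, mul_one_div, one_sub_div h2.ne',
    div_div_div_cancel_right₀ h2.ne']

lemma half_pow_succ_le_half (i : ℕ) : (1 / 2 : ℝ) ^ (i + 1) ≤ 1 / 2 := by
  have h : (1 / 2 : ℝ) ^ i ≤ 1 := pow_le_one₀ (by norm_num) (by norm_num)
  rw [pow_succ]
  linarith

lemma summable_one_div_two_pow_div_sub_one {y : ℝ} (hy : 0 < y) (hy1 : y ≤ 1) :
    Summable fun i : ℕ => 1 / ((2 : ℝ) ^ (i + 1) / y - 1) := by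
  refine Summable.of_nonneg_of_le (fun i => ?_) (fun i => ?_)
    (summable_geometric_of_lt_one (r := (1 / 2 : ℝ)) (by norm_num) (by norm_num))
  all_goals
    rw [one_div_two_pow_div_sub_one i hy]
    have hq : (0 : ℝ) < (1 / 2) ^ (i + 1) := by positivity
    have hz : y * (1 / 2) ^ (i + 1) ≤ (1 / 2) ^ (i + 1) := mul_le_of_le_one_left hq.le hy1
    have hh := half_pow_succ_le_half i
  · exact div_nonneg (by positivity) (by linarith)
  · rw [div_le_iff₀ (by linarith)]
    have hs : (1 / 2 : ℝ) ^ (i + 1) = (1 / 2) ^ i * (1 / 2) := pow_succ _ _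
    have hi : (0 : ℝ) ≤ (1 / 2) ^ i := by positivity
    nlinarith [mul_le_mul_of_nonneg_left (hz.trans hh) hi]

/-- The tail `z / (1 - z) - (z + z² + z³)` of the geometric series is monotone on `[0, 1)`. -/
lemma geom_partial_sub_le {z w : ℝ} (hz : 0 ≤ z) (hzw : z ≤ w) (hw : w < 1) :
    (w + w ^ 2 + w ^ 3) - (z + z ^ 2 + z ^ 3) ≤ w / (1 - w) - z / (1 - z) := by
  have tail (u : ℝ) (hu : u < 1) : u / (1 - u) = u + u ^ 2 + u ^ 3 + u ^ 4 / (1 - u) := by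
    have : 1 - u ≠ 0 := by linarith
    field_simp
    ring
  have hmono : z ^ 4 / (1 - z) ≤ w ^ 4 / (1 - w) :=
    div_le_div₀ (by positivity) (by gcongr) (by linarith) (by linarith)
  rw [tail w hw, tail z (by linarith)]
  linarith

lemma hasSum_half_pow_succ_pow (k : ℕ) (hk : k ≠ 0) :
    HasSum (fun i : ℕ => ((1 / 2 : ℝ) ^ (i + 1)) ^ k) (1 / (2 ^ k - 1)) := by
  have hlt : ((1 / 2 : ℝ) ^ k) < 1 := pow_lt_one₀ (by norm_num) (by norm_num) hk
  have h := (hasSum_geometric_of_lt_one (by positivity) hlt).mul_left ((1 / 2 : ℝ) ^ k)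
  have h2 : (1 : ℝ) < 2 ^ k := one_lt_pow₀ (by norm_num) hk
  have hval : (1 / 2 : ℝ) ^ k * (1 - (1 / 2) ^ k)⁻¹ = 1 / (2 ^ k - 1) := by
    have : (2 : ℝ) ^ k - 1 ≠ 0 := by linarith
    rw [div_pow, one_pow, one_sub_div (by positivity)]
    field_simp
  rw [hval] at h
  have hterm (i : ℕ) : ((1 / 2 : ℝ) ^ (i + 1)) ^ k = (1 / 2) ^ k * ((1 / 2) ^ k) ^ i := by
    rw [pow_right_comm, pow_succ']
  simpa only [hterm] using h

lemma le_tsum_sub_tsum {y b : ℝ} (hy : 0 < y) (hyb : y ≤ b) (hb : b ≤ 1) :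
    (b - y) + (b ^ 2 - y ^ 2) / 3 + (b ^ 3 - y ^ 3) / 7 ≤
      ∑' i : ℕ, 1 / ((2 : ℝ) ^ (i + 1) / b - 1) - ∑' i : ℕ, 1 / ((2 : ℝ) ^ (i + 1) / y - 1) := by
  have hb0 : 0 < b := hy.trans_le hyb
  have hG := (((hasSum_half_pow_succ_pow 1 (by norm_num)).mul_left (b - y)).add
    ((hasSum_half_pow_succ_pow 2 (by norm_num)).mul_left (b ^ 2 - y ^ 2))).add
    ((hasSum_half_pow_succ_pow 3 (by norm_num)).mul_left (b ^ 3 - y ^ 3))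
  have hS := (summable_one_div_two_pow_div_sub_one hb0 hb).hasSum.sub
    (summable_one_div_two_pow_div_sub_one hy (hyb.trans hb)).hasSum
  refine le_trans (le_of_eq ?_) (hasSum_le (fun i => ?_) hG hS)
  · ring
  · rw [one_div_two_pow_div_sub_one i hy, one_div_two_pow_div_sub_one i hb0]
    have hq : (0 : ℝ) < (1 / 2) ^ (i + 1) := by positivity
    have hh := half_pow_succ_le_half i
    have hw : b * (1 / 2) ^ (i + 1) ≤ (1 / 2) ^ (i + 1) := mul_le_of_le_one_left hq.le hb
    refine le_trans (le_of_eq ?_) (geom_partial_sub_le (z := y * (1 / 2) ^ (i + 1))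
      (by positivity) (mul_le_mul_of_nonneg_right hyb hq.le) (by linarith))
    ring

lemma le_symmetric_sum_of_eq_two_mul_div {a b : ℝ} (ha : 0 < a) (hb : b = 2 * a / (1 + a)) :
    a ≤ (a + b) / 3 + (a ^ 2 + a * b + b ^ 2) / 7 := by
  have h : (a + b) / 3 + (a ^ 2 + a * b + b ^ 2) / 7 - a
      = a ^ 2 * (3 * a ^ 2 - 2 * a + 7) / (21 * (1 + a) ^ 2) := by
    rw [hb]
    field_simp
    ring
  have hpos : 0 ≤ a ^ 2 * (3 * a ^ 2 - 2 * a + 7) / (21 * (1 + a) ^ 2) :=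
    div_nonneg (mul_nonneg (by positivity) (by nlinarith [sq_nonneg (a - 1)])) (by positivity)
  linarith

/-- On the interval `[1/(t+1), 1/t]`, the function `λ^t` attains its maximum at
`x = 1/(t+1)`. -/
theorem lamT_le_lamT_left (t : ℕ) (ht : 2 ≤ t) :
    ∀ x ∈ Set.Icc (1 / ((t : ℝ) + 1)) (1 / (t : ℝ)),
      lamT t x ≤ lamT t (1 / ((t : ℝ) + 1)) := by
  rintro x ⟨hx1, hx2⟩
  have ht2 : (2 : ℝ) ≤ t := by exact_mod_cast ht
  have ht0 : (0 : ℝ) < t := by linarith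
  unfold lamT
  generalize (t : ℝ) = s at *
  set a : ℝ := 1 / s with ha
  set y : ℝ := 1 - (s - 1) * x with hy
  set b : ℝ := 1 - (s - 1) * (1 / (s + 1)) with hb
  have ha0 : 0 < a := by positivity
  have hba : b = 2 * a / (1 + a) := by
    rw [hb, ha]
    field_simp
    ring
  have hay : a ≤ y := by
    have h1 : (s - 1) * x ≤ (s - 1) * a := mul_le_mul_of_nonneg_left hx2 (by linarith)
    have h2 : s * a = 1 := by rw [ha]; field_simp
    linarith
  have hyb : y ≤ b := by
    have := mul_le_mul_of_nonneg_left hx1 (show 0 ≤ s - 1 by linarith)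
    linarith
  have hb1 : b ≤ 1 := by
    have : 0 ≤ (s - 1) * (1 / (s + 1)) := mul_nonneg (by linarith) (by positivity)
    linarith
  have hsum := le_tsum_sub_tsum (ha0.trans_le hay) hyb hb1
  have hlin : x * (s - 1) * (s + 1) / s - 1 / (s + 1) * (s - 1) * (s + 1) / s
      = (b - y) * (1 + a) := by
    rw [hb, hy, ha]
    field_simp
    ring
  have hslope : a ≤ (y + b) / 3 + (y ^ 2 + y * b + b ^ 2) / 7 := by
    refine (le_symmetric_sum_of_eq_two_mul_div ha0 hba).trans ?_
    have hb0 : 0 ≤ b := by linarith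
    gcongr
  have hmul := mul_le_mul_of_nonneg_left hslope (sub_nonneg.2 hyb)
  linarith
end

section
/- Let t ≥ 2 be an integer and define λ^t(x) = x·(t−1)·(t+1)/t + ∑_{i=1}^∞ 1/( 2^i/(1 − (t−1)x) − 1 ). Then λ^t(1/(t+1)) > λ^t(1/t); equivalently, λ^t(1/(t+1)) − λ^t(1/t) = 1/t² − ∑_{i=1}^∞ 1/( 2^i·t² + (2^i − 2)·t − 1 + 2^{−i} ) > 0. -/
theorem summable_one_div_two_pow_mul_sub_one {c : ℝ} (hc : 2 ≤ c) :
    Summable fun i : ℕ => 1 / ((2 : ℝ) ^ i * c - 1) := by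
  have hle (i : ℕ) : (2 : ℝ) ^ i ≤ 2 ^ i * c - 1 := by
    have h := one_le_pow₀ (n := i) (one_le_two : (1 : ℝ) ≤ 2)
    nlinarith
  refine Summable.of_nonneg_of_le (fun i => ?_) (fun i => ?_) summable_geometric_two
  · exact one_div_nonneg.2 ((by positivity : (0 : ℝ) ≤ 2 ^ i).trans (hle i))
  · rw [one_div_pow]
    exact one_div_le_one_div_of_le (by positivity) (hle i)

theorem lamT_one_div_succ {t : ℕ} (ht : 2 ≤ t) :
    lamT t (1 / ((t : ℝ) + 1))
      = 1 + ∑' i : ℕ, 1 / ((2 : ℝ) ^ i * (2 * (t + 1)) - 1) := by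
  have ht' : (2 : ℝ) ≤ t := by exact_mod_cast ht
  have hx : 1 - ((t : ℝ) - 1) * (1 / (t + 1)) = 2 / (t + 1) := by field_simp; ring
  have hterm (i : ℕ) : (2 : ℝ) ^ (i + 1) / (2 / ((t : ℝ) + 1)) - 1 = 2 ^ i * (t + 1) - 1 := by
    field_simp; ring
  simp only [lamT, hx, hterm]
  rw [(summable_one_div_two_pow_mul_sub_one (by linarith : (2 : ℝ) ≤ t + 1)).tsum_eq_zero_add]
  simp only [pow_zero, one_mul, add_sub_cancel_right, pow_succ, mul_assoc]
  rw [← add_assoc]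
  congr 1
  field_simp
  ring

theorem lamT_one_div {t : ℕ} (ht : 2 ≤ t) :
    lamT t (1 / (t : ℝ))
      = 1 - 1 / (t : ℝ) ^ 2 + ∑' i : ℕ, 1 / ((2 : ℝ) ^ i * (2 * t) - 1) := by
  have ht' : (2 : ℝ) ≤ t := by exact_mod_cast ht
  have hx : 1 - ((t : ℝ) - 1) * (1 / t) = 1 / t := by field_simp; ring
  have hterm (i : ℕ) : (2 : ℝ) ^ (i + 1) / (1 / (t : ℝ)) - 1 = 2 ^ i * (2 * t) - 1 := by
    field_simp; ring
  simp only [lamT, hx, hterm]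
  congr 1
  field_simp
  ring

theorem one_div_two_pow_mul_sub_one_sub {t : ℝ} (ht : 2 ≤ t) (i : ℕ) :
    1 / ((2 : ℝ) ^ i * (2 * t) - 1) - 1 / ((2 : ℝ) ^ i * (2 * (t + 1)) - 1)
      = 1 / ((2 : ℝ) ^ (i + 1) * t ^ 2
          + ((2 : ℝ) ^ (i + 1) - 2) * t - 1 + ((2 : ℝ) ^ (i + 1))⁻¹) := by
  have hp := one_le_pow₀ (n := i) (one_le_two : (1 : ℝ) ≤ 2)
  rw [pow_succ]
  generalize (2 : ℝ) ^ i = p at *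
  have h1 : 0 < p * (2 * t) - 1 := by nlinarith
  have h2 : 0 < p * (2 * (t + 1)) - 1 := by nlinarith
  have hden : p * 2 * t ^ 2 + (p * 2 - 2) * t - 1 + (p * 2)⁻¹
      = (p * (2 * t) - 1) * (p * (2 * (t + 1)) - 1) / (2 * p) := by
    field_simp
    ring
  rw [hden, div_sub_div _ _ h1.ne' h2.ne', one_div_div]
  ring

theorem tsum_one_div_lt_one_div_sq {t : ℝ} (ht : 2 ≤ t)
    (hs : Summable fun i : ℕ => 1 / ((2 : ℝ) ^ (i + 1) * t ^ 2
      + ((2 : ℝ) ^ (i + 1) - 2) * t - 1 + ((2 : ℝ) ^ (i + 1))⁻¹)) :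
    ∑' i : ℕ, 1 / ((2 : ℝ) ^ (i + 1) * t ^ 2
      + ((2 : ℝ) ^ (i + 1) - 2) * t - 1 + ((2 : ℝ) ^ (i + 1))⁻¹) < 1 / t ^ 2 := by
  have hg : HasSum (fun i : ℕ => (1 / 2 : ℝ) ^ i * (1 / (8 * t ^ 2))) (2 * (1 / (8 * t ^ 2))) :=
    hasSum_geometric_two.mul_right _
  have htail : ∑' i : ℕ, 1 / ((2 : ℝ) ^ (i + 2 + 1) * t ^ 2
      + ((2 : ℝ) ^ (i + 2 + 1) - 2) * t - 1 + ((2 : ℝ) ^ (i + 2 + 1))⁻¹)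
      ≤ 2 * (1 / (8 * t ^ 2)) := by
    rw [← hg.tsum_eq]
    refine ((summable_nat_add_iff 2).2 hs).tsum_le_tsum (fun i => ?_) hg.summable
    have hp := one_le_pow₀ (n := i) (one_le_two : (1 : ℝ) ≤ 2)
    have hinv : 0 ≤ ((2 : ℝ) ^ (i + 2 + 1))⁻¹ := by positivity
    rw [one_div_pow, one_div_mul_one_div]
    refine one_div_le_one_div_of_le (by positivity) ?_
    have hpow : (2 : ℝ) ^ (i + 2 + 1) = 8 * 2 ^ i := by ring
    rw [hpow] at hinv ⊢
    nlinarith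
  have hhead : 1 / (2 * t ^ 2 - 1 / 2) + 1 / (4 * t ^ 2 + 2 * t - 3 / 4)
      < 1 / t ^ 2 - 2 * (1 / (8 * t ^ 2)) := by
    have h1 : 0 < 2 * t ^ 2 - 1 / 2 := by nlinarith
    have h2 : 0 < 4 * t ^ 2 + 2 * t - 3 / 4 := by nlinarith
    have hr : 1 / t ^ 2 - 2 * (1 / (8 * t ^ 2)) = 3 / (4 * t ^ 2) := by field_simp; norm_num
    rw [hr, div_add_div _ _ h1.ne' h2.ne', div_lt_div_iff₀ (by positivity) (by positivity)]
    obtain ⟨u, hu, rfl⟩ : ∃ u : ℝ, 0 ≤ u ∧ t = u + 2 := ⟨t - 2, by linarith, by ring⟩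
    rw [← sub_pos]
    ring_nf
    positivity
  rw [← hs.sum_add_tsum_nat_add 2, Finset.sum_range_succ, Finset.sum_range_one]
  have h0 : (2 : ℝ) ^ (0 + 1) * t ^ 2 + ((2 : ℝ) ^ (0 + 1) - 2) * t - 1
      + ((2 : ℝ) ^ (0 + 1))⁻¹ = 2 * t ^ 2 - 1 / 2 := by ring
  have h1 : (2 : ℝ) ^ (1 + 1) * t ^ 2 + ((2 : ℝ) ^ (1 + 1) - 2) * t - 1
      + ((2 : ℝ) ^ (1 + 1))⁻¹ = 4 * t ^ 2 + 2 * t - 3 / 4 := by ring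
  rw [h0, h1]
  linarith

/-- `λ^t(1/(t+1)) > λ^t(1/t)`; equivalently, the difference equals
`1/t² - ∑_{i=1}^∞ 1/(2^i·t² + (2^i - 2)·t - 1 + 2^{-i}) > 0`. -/
theorem lamT_left_gt_right (t : ℕ) (ht : 2 ≤ t) :
    lamT t (1 / ((t : ℝ) + 1)) > lamT t (1 / (t : ℝ))
    ∧ lamT t (1 / ((t : ℝ) + 1)) - lamT t (1 / (t : ℝ))
        = 1 / (t : ℝ) ^ 2
          - ∑' i : ℕ, 1 / ((2 : ℝ) ^ (i + 1) * (t : ℝ) ^ 2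
              + ((2 : ℝ) ^ (i + 1) - 2) * (t : ℝ) - 1 + ((2 : ℝ) ^ (i + 1))⁻¹) := by
  have ht' : (2 : ℝ) ≤ t := by exact_mod_cast ht
  have ha := summable_one_div_two_pow_mul_sub_one (by linarith : (2 : ℝ) ≤ 2 * ((t : ℝ) + 1))
  have hb := summable_one_div_two_pow_mul_sub_one (by linarith : (2 : ℝ) ≤ 2 * (t : ℝ))
  have hs := hb.sub ha
  have hsub := hb.tsum_sub ha
  simp only [one_div_two_pow_mul_sub_one_sub ht'] at hs hsub
  have hlt := tsum_one_div_lt_one_div_sq ht' hs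
  rw [lamT_one_div_succ ht, lamT_one_div ht]
  exact ⟨by linarith, by linarith⟩
end

section
/- Let t ≥ 2 be an integer. For every δ > 0 there exists a finite list I of items with sizes in (0, 1/t], a subset-sum (SS) packing of I using m bins, and a packing of I using n bins, such that m ≥ (λ^t − δ)·n, where λ^t = 1 + ∑_{i=1}^∞ 1/( (t+1)·2^i − 1 ). -/
/-- Relabelling items and bins by `Fin`, with the bins in increasing order. -/
theorem exists_fin_packings {ι β γ : Type*} [Fintype ι] [Fintype β] [LinearOrder β] [Fintype γ]
    [DecidableEq γ] (size : ι → ℝ) (f : ι → β) (g : ι → γ)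
    (hf : Function.Surjective f) (hf1 : ∀ b, ∑ i with f i = b, size i ≤ 1)
    (hfS : ∀ b, ∀ S : Finset ι, (∀ i ∈ S, b ≤ f i) → ∑ i ∈ S, size i ≤ 1 →
      ∑ i ∈ S, size i ≤ ∑ i with f i = b, size i)
    (hg : Function.Surjective g) (hg1 : ∀ c, ∑ i with g i = c, size i ≤ 1) :
    ∃ (e : Fin (Fintype.card ι) ≃ ι) (f' : Fin (Fintype.card ι) → Fin (Fintype.card β))
      (g' : Fin (Fintype.card ι) → Fin (Fintype.card γ)),
      IsSSPacking (size ∘ e) _ f' ∧ IsPacking (size ∘ e) _ g' := by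
  let e := (Fintype.equivFin ι).symm
  let o : Fin (Fintype.card β) ≃o β := Fintype.orderIsoFinOfCardEq β rfl
  let c := Fintype.equivFin γ
  have hload : ∀ k, binLoad (size ∘ e) (fun i => o.symm (f (e i))) k
      = ∑ i with f i = o k, size i := by
    intro k
    simp only [binLoad, Finset.sum_filter, Function.comp_apply, OrderIso.symm_apply_eq]
    exact e.sum_comp (fun i => if f i = o k then size i else 0)
  have hload' : ∀ k, binLoad (size ∘ e) (fun i => c (g (e i))) k
      = ∑ i with g i = c.symm k, size i := by
    intro k
    simp only [binLoad, Finset.sum_filter, Function.comp_apply, ← Equiv.eq_symm_apply]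
    exact e.sum_comp (fun i => if g i = c.symm k then size i else 0)
  refine ⟨e, fun i => o.symm (f (e i)), fun i => c (g (e i)), ⟨⟨?_, ?_⟩, ?_⟩, ?_, ?_⟩
  · exact o.symm.surjective.comp (hf.comp e.surjective)
  · intro k
    rw [hload]
    exact hf1 _
  · intro k S hS hS1
    have hmap : ∑ i ∈ S, (size ∘ e) i = ∑ i ∈ S.map e.toEmbedding, size i := by
      simp
    rw [hload, hmap]
    rw [hmap] at hS1
    refine hfS _ _ (fun i hi => ?_) hS1
    obtain ⟨a, ha, rfl⟩ := Finset.mem_map.1 hi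
    exact o.le_symm_apply.1 (hS a ha)
  · exact c.surjective.comp (hg.comp e.surjective)
  · intro k
    rw [hload']
    exact hg1 _

/-- If every item is a positive multiple of `1 / M` increased by `ε`, then no subset fitting in a
bin beats `M - 1` items of size `1 / M + ε`. -/
theorem sum_le_of_multiples {ι : Type*} (S : Finset ι) (a : ι → ℕ) (M : ℕ) (hM : 0 < M) {ε : ℝ}
    (hε : 0 < ε) (ha : ∀ i ∈ S, 1 ≤ a i) (hS : ∑ i ∈ S, ((a i : ℝ) / M + ε) ≤ 1) :
    ∑ i ∈ S, ((a i : ℝ) / M + ε) ≤ ((M - 1 : ℕ) : ℝ) * (1 / M + ε) := by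
  rcases S.eq_empty_or_nonempty with rfl | hne
  · rw [Finset.sum_empty]
    positivity
  have hM' : (0 : ℝ) < M := by exact_mod_cast hM
  have hsum : ∑ i ∈ S, ((a i : ℝ) / M + ε) = ((∑ i ∈ S, a i : ℕ) : ℝ) / M + S.card * ε := by
    rw [Finset.sum_add_distrib, ← Finset.sum_div]
    simp
  have hcard : S.card ≤ ∑ i ∈ S, a i := by
    simpa using Finset.sum_le_sum ha
  rw [hsum] at hS ⊢
  have hpos : 0 < (S.card : ℝ) * ε := mul_pos (by exact_mod_cast hne.card_pos) hε
  have hlt : ((∑ i ∈ S, a i : ℕ) : ℝ) < M := by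
    have : ((∑ i ∈ S, a i : ℕ) : ℝ) / M < 1 := by linarith
    rwa [div_lt_one hM'] at this
  have hle : ∑ i ∈ S, a i ≤ M - 1 := Nat.le_sub_one_of_lt (by exact_mod_cast hlt)
  calc ((∑ i ∈ S, a i : ℕ) : ℝ) / M + S.card * ε
      ≤ ((∑ i ∈ S, a i : ℕ) : ℝ) / M + ((∑ i ∈ S, a i : ℕ) : ℝ) * ε := by gcongr
    _ = ((∑ i ∈ S, a i : ℕ) : ℝ) * (1 / M + ε) := by ring
    _ ≤ ((M - 1 : ℕ) : ℝ) * (1 / M + ε) := by gcongr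

/-- Items of size `1 / M j + ε`, with `w j` items of level `j` in each of `n` bins, have an SS
packing which fills bins level by level, starting from the smallest items. -/
theorem exists_packings_of_levels (k n : ℕ) (M w p : Fin (k + 1) → ℕ) {ε : ℝ} (hε : 0 < ε)
    (hM : ∀ j, 2 ≤ M j) (hdvd : ∀ i j, i ≤ j → M i ∣ M j)
    (hp : ∀ j, p j * (M j - 1) = n * w j) (hw : ∀ j, 0 < w j)
    (hfit : ∀ j, ((M j - 1 : ℕ) : ℝ) * (1 / M j + ε) ≤ 1)
    (hopt : ∑ j, (w j : ℝ) * (1 / M j + ε) ≤ 1) :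
    ∃ (N : ℕ) (size : Fin N → ℝ) (f : Fin N → Fin (∑ j, p j)) (g : Fin N → Fin n),
      (∀ i, ∃ j, size i = 1 / (M j : ℝ) + ε) ∧
      IsSSPacking size (∑ j, p j) f ∧ IsPacking size n g := by
  let B := Lex (Σ j, Fin (p j))
  let lvl : B → Fin (k + 1) := fun b => (ofLex b).1
  let I := Σ b : B, Fin (M (lvl b) - 1)
  have hcard : ∀ j, Fintype.card (Fin (p j) × Fin (M j - 1)) = Fintype.card (Fin n × Fin (w j)) :=
    fun j => by simpa using hp j
  let E : ∀ j, Fin (p j) × Fin (M j - 1) ≃ Fin n × Fin (w j) :=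
    fun j => Fintype.equivOfCardEq (hcard j)
  let size : I → ℝ := fun i => 1 / (M (lvl i.1) : ℝ) + ε
  let f : I → Bᵒᵈ := fun i => OrderDual.toDual i.1
  let g : I → Fin n := fun i => (E (lvl i.1) ((ofLex i.1).2, i.2)).1
  have hload : ∀ b : Bᵒᵈ, ∑ i with f i = b, size i =
      ((M (lvl (OrderDual.ofDual b)) - 1 : ℕ) : ℝ) *
        (1 / M (lvl (OrderDual.ofDual b)) + ε) := by
    intro b
    rw [Finset.sum_filter, Fintype.sum_sigma,
      Finset.sum_eq_single (OrderDual.ofDual b)]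
    · simp [f, size, mul_add]
    · intro c _ hc
      refine Finset.sum_eq_zero fun r _ => if_neg fun h => hc ?_
      exact congrArg OrderDual.ofDual h
    · simp
  have hf : Function.Surjective f := by
    intro b
    have := hM (lvl (OrderDual.ofDual b))
    exact ⟨⟨OrderDual.ofDual b, ⟨0, by omega⟩⟩, rfl⟩
  have hg : Function.Surjective g := by
    intro c
    let x := (E 0).symm (c, ⟨0, hw 0⟩)
    refine ⟨⟨toLex ⟨0, x.1⟩, x.2⟩, ?_⟩
    change (E 0 ((E 0).symm (c, ⟨0, hw 0⟩))).1 = c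
    rw [Equiv.apply_symm_apply]
  have hloadg : ∀ c, ∑ i with g i = c, size i = ∑ j, (w j : ℝ) * (1 / M j + ε) := by
    intro c
    rw [Finset.sum_filter, Fintype.sum_sigma,
      ← (toLex : (Σ j, Fin (p j)) ≃ B).sum_comp, Fintype.sum_sigma]
    refine Finset.sum_congr rfl fun j _ => ?_
    calc ∑ q : Fin (p j), ∑ r : Fin (M j - 1),
          (if (E j (q, r)).1 = c then 1 / (M j : ℝ) + ε else 0)
        = ∑ x : Fin (p j) × Fin (M j - 1),
          (if (E j x).1 = c then 1 / (M j : ℝ) + ε else 0) := by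
          rw [Fintype.sum_prod_type]
      _ = ∑ y : Fin n × Fin (w j), (if y.1 = c then 1 / (M j : ℝ) + ε else 0) :=
          (E j).sum_comp (fun y => if y.1 = c then 1 / (M j : ℝ) + ε else 0)
      _ = (w j : ℝ) * (1 / M j + ε) := by
          rw [Fintype.sum_prod_type]
          simp [mul_add]
  have hss : ∀ b : Bᵒᵈ, ∀ S : Finset I, (∀ i ∈ S, b ≤ f i) → ∑ i ∈ S, size i ≤ 1 →
      ∑ i ∈ S, size i ≤ ∑ i with f i = b, size i := by
    intro b S hS hS1
    rw [hload]
    set j := lvl (OrderDual.ofDual b)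
    have hlvl : ∀ i ∈ S, lvl i.1 ≤ j := by
      intro i hi
      rcases Sigma.Lex.le_def.1 (show i.1 ≤ OrderDual.ofDual b from hS i hi) with h | ⟨h, _⟩
      · exact h.le
      · exact h.le
    have hpos : ∀ j, 0 < M j := fun j => lt_of_lt_of_le two_pos (hM j)
    have hsize : ∀ i ∈ S, size i = ((M j / M (lvl i.1) : ℕ) : ℝ) / M j + ε := by
      intro i hi
      have h1 : (M (lvl i.1) : ℝ) ≠ 0 := by exact_mod_cast (hpos _).ne'
      have h2 : (M j : ℝ) ≠ 0 := by exact_mod_cast (hpos _).ne'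
      rw [Nat.cast_div (hdvd _ _ (hlvl i hi)) h1]
      simp only [size]
      field_simp
    rw [Finset.sum_congr rfl hsize] at hS1 ⊢
    refine sum_le_of_multiples S _ (M j) (hpos j) hε (fun i hi => ?_) hS1
    exact Nat.div_pos (Nat.le_of_dvd (hpos j) (hdvd _ _ (hlvl i hi))) (hpos _)
  obtain ⟨e, f', g', hf', hg'⟩ := exists_fin_packings size f g hf
    (fun b => (hload b).trans_le (hfit _)) hss hg (fun c => (hloadg c).trans_le hopt)
  have hB : Fintype.card Bᵒᵈ = ∑ j, p j := by
    change Fintype.card (Σ j, Fin (p j)) = _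
    simp
  have hn : Fintype.card (Fin n) = n := Fintype.card_fin n
  generalize Fintype.card Bᵒᵈ = m at hB f' hf'
  generalize Fintype.card (Fin n) = n' at hn g' hg'
  subst hB hn
  exact ⟨_, size ∘ e, f', g', fun i => ⟨lvl (e i).1, rfl⟩, hf', hg'⟩

theorem sum_one_div_mul_two_pow (a : ℝ) (ha : a ≠ 0) (k : ℕ) :
    ∑ i ∈ Finset.range k, 1 / (a * 2 ^ (i + 1)) = 1 / a - 1 / (a * 2 ^ k) := by
  induction k with
  | zero => simp
  | succ k ih =>
    rw [Finset.sum_range_succ, ih]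
    field_simp
    ring

theorem summable_one_div_mul_two_pow_sub_one (t : ℕ) (ht : 1 ≤ t) :
    Summable fun i : ℕ => 1 / (((t : ℝ) + 1) * 2 ^ (i + 1) - 1) := by
  have ht' : (1 : ℝ) ≤ t := by exact_mod_cast ht
  have key : ∀ i : ℕ, (2 : ℝ) ^ i ≤ ((t : ℝ) + 1) * 2 ^ (i + 1) - 1 := by
    intro i
    have : (1 : ℝ) ≤ 2 ^ i := one_le_pow₀ (by norm_num)
    rw [pow_succ]
    nlinarith
  refine Summable.of_nonneg_of_le (fun i => ?_) (fun i => ?_) summable_geometric_two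
  · exact one_div_nonneg.2 ((by positivity : (0 : ℝ) ≤ 2 ^ i).trans (key i))
  · rw [div_pow, one_pow]
    exact one_div_le_one_div_of_le (by positivity) (key i)

/-- The bad instance with `k` levels below `1 / (t + 1)`. -/
theorem exists_packings_of_truncation (t : ℕ) (ht : 1 ≤ t) (k : ℕ) :
    ∃ (N m n : ℕ) (size : Fin N → ℝ) (f : Fin N → Fin m) (g : Fin N → Fin n),
      (∀ i, size i ∈ Set.Ioc (0 : ℝ) (1 / (t : ℝ))) ∧
      IsSSPacking size m f ∧ IsPacking size n g ∧
      (m : ℝ) = (1 + ∑ i ∈ Finset.range k, 1 / (((t : ℝ) + 1) * 2 ^ (i + 1) - 1)) * n := by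
  let M : ℕ → ℕ := fun j => (t + 1) * 2 ^ j
  let n : ℕ := ∏ i ∈ Finset.range k, (M (i + 1) - 1)
  let w : ℕ → ℕ := fun j => if j = 0 then t else 1
  let p : ℕ → ℕ := fun j => if j = 0 then n else n / (M j - 1)
  let ε : ℝ := 1 / (M k : ℝ) ^ 2
  have hM2 : ∀ j, 2 ≤ M j := fun j => by
    have := Nat.one_le_two_pow (n := j)
    simp only [M]
    nlinarith
  have hM0 : ∀ j, (0 : ℝ) < M j := fun j => by
    exact_mod_cast lt_of_lt_of_le two_pos (hM2 j)
  have hdvd : ∀ i j, i ≤ j → M i ∣ M j := fun i j h => mul_dvd_mul_left _ (pow_dvd_pow 2 h)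
  have hMle : ∀ j ≤ k, (M j : ℝ) ≤ M k := fun j h => by
    exact_mod_cast Nat.le_of_dvd (lt_of_lt_of_le two_pos (hM2 k)) (hdvd j k h)
  have hε : 0 < ε := by have := hM0 k; positivity
  have hndvd : ∀ i < k, M (i + 1) - 1 ∣ n := fun i h =>
    Finset.dvd_prod_of_mem (fun i => M (i + 1) - 1) (Finset.mem_range.2 h)
  have hp : ∀ j : Fin (k + 1), p j * (M j - 1) = n * w j := by
    rintro ⟨j, hj⟩
    rcases j with _ | j
    · simp [p, w, M]
    · simp only [p, w, Nat.succ_ne_zero, if_false, mul_one]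
      exact Nat.div_mul_cancel (hndvd j (by omega))
  have hMε : (M k : ℝ) * ε = 1 / M k := by
    have := hM0 k
    simp only [ε]
    field_simp
  have hfit : ∀ j : Fin (k + 1), ((M j - 1 : ℕ) : ℝ) * (1 / M j + ε) ≤ 1 := by
    intro j
    have h1 := hMle j (by omega)
    have h0 := hM0 j
    have h2 : (M j : ℝ) * ε ≤ 1 / M j :=
      (mul_le_mul_of_nonneg_right h1 hε.le).trans
        (hMε.trans_le (one_div_le_one_div_of_le h0 h1))
    have h3 : (M j : ℝ) * (1 / M j) = 1 := by field_simp
    rw [Nat.cast_sub ((by norm_num : 1 ≤ 2).trans (hM2 j)), Nat.cast_one]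
    nlinarith
  have ht0 : (0 : ℝ) < t := by exact_mod_cast ht
  have hopt : ∑ j : Fin (k + 1), (w j : ℝ) * (1 / M j + ε) ≤ 1 := by
    have hterm : ∀ i : ℕ, (w (i + 1) : ℝ) * (1 / M (i + 1) + ε)
        = 1 / (((t : ℝ) + 1) * 2 ^ (i + 1)) + ε := fun i => by simp [w, M]
    have h0 : (w 0 : ℝ) * (1 / M 0 + ε) = t * (1 / ((t : ℝ) + 1) + ε) := by simp [w, M]
    have hsmall : (t : ℝ) + k ≤ M k := by
      have : k + 1 ≤ 2 ^ k := Nat.lt_two_pow_self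
      have : t + k ≤ M k := by simp only [M]; nlinarith
      exact_mod_cast this
    have h4 := mul_le_mul_of_nonneg_right hsmall hε.le
    have hMk : ((t : ℝ) + 1) * 2 ^ k = M k := by simp [M]
    have h5 : (t : ℝ) * (1 / (t + 1)) + 1 / (t + 1) = 1 := by field_simp
    rw [Fin.sum_univ_eq_sum_range (fun j => (w j : ℝ) * (1 / M j + ε)), Finset.sum_range_succ',
      Finset.sum_congr rfl fun i _ => hterm i, Finset.sum_add_distrib,
      sum_one_div_mul_two_pow _ (by positivity), h0, hMk, Finset.sum_const, Finset.card_range,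
      nsmul_eq_mul]
    linarith
  obtain ⟨N, size, f, g, hsize, hf, hg⟩ := exists_packings_of_levels k n (fun j => M j)
    (fun j => w j) (fun j => p j) hε (fun j => hM2 j) (fun i j h => hdvd i j h) hp
    (fun j => by simp only [w]; split_ifs <;> omega) hfit hopt
  refine ⟨N, _, n, size, f, g, fun i => ?_, hf, hg, ?_⟩
  · obtain ⟨j, hj⟩ := hsize i
    rw [hj]
    have hMj := hM0 j
    have hlb : ∀ j, (t : ℝ) + 1 ≤ M j := fun j => by
      have : t + 1 ≤ M j := Nat.le_mul_of_pos_right _ (by positivity)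
      exact_mod_cast this
    refine ⟨by positivity, ?_⟩
    have h1 : 1 / (M j : ℝ) ≤ 1 / (t + 1) := one_div_le_one_div_of_le (by positivity) (hlb j)
    have h2 : ε ≤ 1 / ((t : ℝ) * (t + 1)) := by
      refine one_div_le_one_div_of_le (by positivity) ?_
      nlinarith [hlb k]
    have h3 : 1 / ((t : ℝ) + 1) + 1 / ((t : ℝ) * (t + 1)) = 1 / t := by
      field_simp
    linarith
  · rw [Fin.sum_univ_eq_sum_range p, Finset.sum_range_succ', Nat.cast_add, Nat.cast_sum, add_mul,
      Finset.sum_mul, one_mul, add_comm]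
    congr 1
    refine Finset.sum_congr rfl fun i hi => ?_
    have hMi := hM2 (i + 1)
    have hne : ((M (i + 1) - 1 : ℕ) : ℝ) ≠ 0 := by
      exact_mod_cast (by omega : M (i + 1) - 1 ≠ 0)
    simp only [p, Nat.succ_ne_zero, if_false]
    rw [Nat.cast_div (hndvd i (Finset.mem_range.1 hi)) hne,
      Nat.cast_sub (by omega : 1 ≤ M (i + 1))]
    simp only [M]
    push_cast
    ring

/-- Parametric lower bound for the Subset Sum algorithm: for every `t ≥ 2` and
`δ > 0` there is an instance with sizes in `(0, 1/t]`, an SS packing into `m`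
bins and a packing into `n` bins with `m ≥ (λ^t - δ)·n` where
`λ^t = 1 + ∑_{i=1}^∞ 1/((t+1)·2^i - 1)`. -/
theorem ssPacking_parametric_lower_bound (t : ℕ) (ht : 2 ≤ t) (δ : ℝ) (hδ : 0 < δ) :
    ∃ (N m n : ℕ) (size : Fin N → ℝ) (f : Fin N → Fin m) (g : Fin N → Fin n),
      (∀ i, size i ∈ Set.Ioc (0 : ℝ) (1 / (t : ℝ))) ∧
      IsSSPacking size m f ∧ IsPacking size n g ∧
      ((1 + ∑' i : ℕ, 1 / (((t : ℝ) + 1) * 2 ^ (i + 1) - 1)) - δ) * n ≤ (m : ℝ) := by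
  obtain ⟨k, hk⟩ := ((summable_one_div_mul_two_pow_sub_one t
    (by omega)).hasSum.tendsto_sum_nat.eventually_const_lt (sub_lt_self _ hδ)).exists
  obtain ⟨N, m, n, size, f, g, hsize, hf, hg, hm⟩ :=
    exists_packings_of_truncation t (by omega) k
  refine ⟨N, m, n, size, f, g, hsize, hf, hg, ?_⟩
  rw [hm]
  refine mul_le_mul_of_nonneg_right ?_ n.cast_nonneg
  linarith
end
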